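/- For all integers N ≥ 0 and n ≥ 1, one has −(6√2/π^{3/2}) · cosh(π/6) · (√(2N+2)/(√(24n))^{2N+1}) · √(1 − 1/(4N+5)) − exp(−(π/2)√(2n/3)) < R_{2N+1}(n) < exp(−(π/2)√(2n/3)). -/

import Mathlib

open Real Finset Filter Topology

noncomputable def c (m : ℕ) : ℝ :=
  ((-1 : ℝ) ^ m / (4 * Real.sqrt 6) ^ m) *
    ∑ k ∈ Finset.range ((m + 1) / 2 + 1),
      ((m + 1).choose k : ℝ) * ((m + 1 - k : ℕ) : ℝ) / ((m + 1 - 2 * k).factorial : ℝ) *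
        (π / 6) ^ ((m : ℤ) - 2 * k)

/-- The number of partitions of `n`, as a real number. -/
noncomputable def p (n : ℕ) : ℝ := (Fintype.card (Nat.Partition n) : ℝ)

/-- The remainder after `N` terms of the asymptotic expansion. -/
noncomputable def R (N n : ℕ) : ℝ :=
  4 * Real.sqrt 3 * (n : ℝ) * Real.exp (-(π * Real.sqrt (2 * n / 3))) * p n -
    ∑ m ∈ Finset.range N, c m / (n : ℝ) ^ ((m : ℝ) / 2)

namespace PartitionExpansion

section

/-! ### Powers of the Catalan generating function -/

/-- The series `∑ k, binom (j + 2k) k * r ^ k`. -/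
noncomputable def catalanPowSeries (r : ℝ) (j : ℕ) : ℝ :=
  ∑' k : ℕ, ((j + 2 * k).choose k : ℝ) * r ^ k

lemma choose_le_two_pow_mul (j k : ℕ) : ((j + 2 * k).choose k : ℝ) ≤ 2 ^ j * 4 ^ k := by
  have : ((j + 2 * k).choose k) ≤ 2 ^ (j + 2 * k) := Nat.choose_le_two_pow _ _
  calc ((j + 2 * k).choose k : ℝ) ≤ (2 : ℝ) ^ (j + 2 * k) := by exact_mod_cast this
    _ = 2 ^ j * 4 ^ k := by rw [pow_add, pow_mul]; norm_num

variable {r : ℝ}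

lemma summable_catalanPow (h0 : 0 ≤ r) (h1 : r ≤ 1 / 64) (j : ℕ) :
    Summable fun k : ℕ => ((j + 2 * k).choose k : ℝ) * r ^ k := by
  refine Summable.of_nonneg_of_le (fun k => by positivity) (fun k => ?_)
    ((summable_geometric_of_lt_one (r := 4 * r) (by positivity) (by linarith)).mul_left (2 ^ j))
  calc ((j + 2 * k).choose k : ℝ) * r ^ k ≤ 2 ^ j * 4 ^ k * r ^ k := by
        gcongr; exact choose_le_two_pow_mul j k
    _ = _ := by rw [mul_pow]; ring

lemma catalanPowSeries_le (h0 : 0 ≤ r) (h1 : r ≤ 1 / 64) (j : ℕ) :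
    catalanPowSeries r j ≤ 2 ^ j * 2 := by
  have hs := summable_geometric_of_lt_one (r := 4 * r) (by positivity) (by linarith)
  calc catalanPowSeries r j ≤ ∑' k : ℕ, 2 ^ j * (4 * r) ^ k := by
        refine (summable_catalanPow h0 h1 j).tsum_le_tsum (fun k => ?_) (hs.mul_left _)
        calc ((j + 2 * k).choose k : ℝ) * r ^ k ≤ 2 ^ j * 4 ^ k * r ^ k := by
              gcongr; exact choose_le_two_pow_mul j k
          _ = _ := by rw [mul_pow]; ring
    _ = 2 ^ j * (1 - 4 * r)⁻¹ := by
        rw [tsum_mul_left, tsum_geometric_of_lt_one (by positivity) (by linarith)]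
    _ ≤ 2 ^ j * 2 := by
        gcongr
        rw [inv_le_comm₀ (by linarith) (by norm_num)]; linarith

lemma catalanPowSeries_nonneg (h0 : 0 ≤ r) (j : ℕ) : 0 ≤ catalanPowSeries r j :=
  tsum_nonneg fun k => by positivity

lemma catalanPowSeries_succ (h0 : 0 ≤ r) (h1 : r ≤ 1 / 64) (j : ℕ) :
    catalanPowSeries r (j + 1) = catalanPowSeries r j + r * catalanPowSeries r (j + 2) := by
  unfold catalanPowSeries
  have e1 := (summable_catalanPow h0 h1 (j + 1)).tsum_eq_zero_add
  have e2 := (summable_catalanPow h0 h1 j).tsum_eq_zero_add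
  rw [e1, e2, ← tsum_mul_left, add_assoc (((j + 2 * 0).choose 0 : ℝ) * r ^ 0),
    ← ((summable_nat_add_iff 1).mpr (summable_catalanPow h0 h1 j)).tsum_add
      ((summable_catalanPow h0 h1 (j + 2)).mul_left r)]
  congr 1
  · simp
  · refine tsum_congr fun k => ?_
    rw [show j + 1 + 2 * (k + 1) = (j + 2 * (k + 1)) + 1 by ring, Nat.choose_succ_succ,
      show j + 2 + 2 * k = j + 2 * (k + 1) by ring]
    push_cast
    ring

lemma catalanPowSeries_zero (h0 : 0 ≤ r) (h1 : r ≤ 1 / 64) :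
    catalanPowSeries r 0 = 1 + 2 * r * catalanPowSeries r 1 := by
  unfold catalanPowSeries
  rw [(summable_catalanPow h0 h1 0).tsum_eq_zero_add, ← tsum_mul_left]
  congr 1
  · simp
  · refine tsum_congr fun k => ?_
    have : (0 + 2 * (k + 1)).choose (k + 1) = 2 * (1 + 2 * k).choose k := by
      rw [show 0 + 2 * (k + 1) = (2 * k + 1) + 1 by ring, Nat.choose_succ_succ,
        show 1 + 2 * k = 2 * k + 1 by ring, Nat.choose_symm_half]
      ring
    rw [this]
    push_cast
    ring

/-- Closed form: with `s = √(1 - 4r)`, the series is `(2 / (1 + s)) ^ j / s`. -/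
lemma catalanPowSeries_eq (h0 : 0 < r) (h1 : r ≤ 1 / 64) {s : ℝ} (hs0 : 0 < s)
    (hs : s ^ 2 = 1 - 4 * r) (j : ℕ) : catalanPowSeries r j = (2 / (1 + s)) ^ j / s := by
  set C : ℝ := 2 / (1 + s) with hC
  have hs1 : s ≤ 1 := by nlinarith
  have hCpos : 0 < C := by positivity
  have hC2 : C ≤ 2 := by rw [hC, div_le_iff₀ (by linarith)]; linarith
  have hr : r = (1 - s ^ 2) / 4 := by linarith
  have hrC : r * C = (1 - s) / 2 := by rw [hr, hC]; field_simp; ring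
  have hroot : (1 - r * C) * C = 1 := by rw [hrC, hC]; field_simp; ring
  have hrCpos : 0 < r * C := by positivity
  have hrC32 : r * C ≤ 1 / 32 := by nlinarith
  set d : ℕ → ℝ := fun j => catalanPowSeries r (j + 1) - C * catalanPowSeries r j with hd
  have hrec : ∀ j, r * C * d (j + 1) = d j := fun j => by
    have := catalanPowSeries_succ h0.le h1 j
    simp only [hd]
    have h2 : r * catalanPowSeries r (j + 1 + 1)
      = catalanPowSeries r (j + 1) - catalanPowSeries r j := by linarith
    calc r * C * (catalanPowSeries r (j + 1 + 1) - C * catalanPowSeries r (j + 1))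
        = C * (r * catalanPowSeries r (j + 1 + 1)) - (r * C) * C * catalanPowSeries r (j + 1) := by
          ring
      _ = _ := by
        rw [h2]
        linear_combination catalanPowSeries r (j + 1) * hroot
  have hpow : ∀ j, (r * C) ^ j * d j = d 0 := by
    intro j
    induction j with
    | zero => simp
    | succ k ih => rw [← ih, ← hrec k]; ring
  have hbd : ∀ j, |d j| ≤ 2 ^ j * 8 := fun j => by
    have a1 := catalanPowSeries_nonneg h0.le (j + 1)
    have a2 := catalanPowSeries_nonneg h0.le j
    have a3 := catalanPowSeries_le h0.le h1 (j + 1)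
    have a4 := catalanPowSeries_le h0.le h1 j
    rw [pow_succ] at a3
    rw [abs_le]
    simp only [hd]
    constructor <;> nlinarith [pow_pos (show (0 : ℝ) < 2 by norm_num) j, mul_nonneg hCpos.le a2]
  have hd0 : d 0 = 0 := by
    have hle : ∀ j, |d 0| ≤ (1 / 16 : ℝ) ^ j * 8 := fun j => by
      rw [← hpow j, abs_mul, abs_of_nonneg (by positivity)]
      calc (r * C) ^ j * |d j| ≤ (1 / 32) ^ j * (2 ^ j * 8) := by
            gcongr
            exact hbd j
        _ = _ := by rw [← mul_assoc, ← mul_pow]; norm_num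
    have ht : Tendsto (fun j : ℕ => (1 / 16 : ℝ) ^ j * 8) atTop (𝓝 (0 * 8)) :=
      (tendsto_pow_atTop_nhds_zero_of_lt_one (by norm_num) (by norm_num)).mul_const _
    rw [zero_mul] at ht
    exact abs_eq_zero.mp (le_antisymm (ge_of_tendsto' ht hle) (abs_nonneg _))
  have hdz : ∀ j, d j = 0 := fun j => by
    have := hpow j
    rw [hd0] at this
    exact (mul_eq_zero.mp this).resolve_left (by positivity)
  have hstep : ∀ j, catalanPowSeries r (j + 1) = C * catalanPowSeries r j := fun j => by
    have := hdz j
    simp only [hd] at this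
    linarith
  have hf0 : catalanPowSeries r 0 = 1 / s := by
    have h := catalanPowSeries_zero h0.le h1
    rw [hstep 0] at h
    field_simp
    linear_combination h + (2 * catalanPowSeries r 0) * hrC
  induction j with
  | zero => simpa using hf0
  | succ k ih => rw [hstep, ih]; ring

lemma mul_choose_shift (j k : ℕ) :
    ((j : ℝ) + 1 + k) * ((j + 2 * (k + 1)).choose (k + 1)) =
      (4 * ((j : ℝ) + k)) * ((j + 2 * k).choose k) +
      (j * ((j + 2 * (k + 1)).choose (k + 1)) - j * ((j + 1 + 2 * k).choose k) +
        (2 - 2 * j) * ((j + 2 * k).choose k)) := by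
  have e1 : ((j : ℝ) + k + 1) * (k + 1) * ((j + 2 * (k + 1)).choose (k + 1)) =
      (j + 2 * k + 2) * (j + 2 * k + 1) * ((j + 2 * k).choose k) := by
    have h1 := Nat.add_one_mul_choose_eq (j + 2 * k + 1) k
    have h3 := Nat.choose_mul_succ_eq (j + 2 * k) k
    rw [show j + 2 * k + 1 - k = j + k + 1 by omega] at h3
    rw [show j + 2 * (k + 1) = j + 2 * k + 1 + 1 by ring]
    have h1' : ((j : ℝ) + 2 * k + 1 + 1) * ((j + 2 * k + 1).choose k) =
      ((j + 2 * k + 1 + 1).choose (k + 1)) * (k + 1) := by exact_mod_cast h1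
    have h3' : (((j + 2 * k).choose k : ℕ) : ℝ) * (j + 2 * k + 1) =
      ((j + 2 * k + 1).choose k) * (j + k + 1) := by exact_mod_cast h3
    linear_combination (-(j : ℝ) - k - 1) * h1' - (j + 2 * k + 2 : ℝ) * h3'
  have e2 : ((j : ℝ) + k + 1) * ((j + 1 + 2 * k).choose k) =
      (j + 2 * k + 1) * ((j + 2 * k).choose k) := by
    have h3 := Nat.choose_mul_succ_eq (j + 2 * k) k
    rw [show j + 2 * k + 1 - k = j + k + 1 by omega] at h3
    rw [show j + 1 + 2 * k = j + 2 * k + 1 by ring]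
    have h3' : (((j + 2 * k).choose k : ℕ) : ℝ) * (j + 2 * k + 1) =
      ((j + 2 * k + 1).choose k) * (j + k + 1) := by exact_mod_cast h3
    linear_combination -h3'
  have hne : ((j : ℝ) + k + 1) ≠ 0 := by positivity
  apply mul_left_cancel₀ hne
  linear_combination e1 + j * e2

lemma summable_mul_catalanPow (h0 : 0 ≤ r) (h1 : r ≤ 1 / 64) (j : ℕ) :
    Summable fun k : ℕ => ((j : ℝ) + k) * ((j + 2 * k).choose k : ℝ) * r ^ k := by
  refine Summable.of_nonneg_of_le (fun k => by positivity) (fun k => ?_)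
    ((summable_geometric_of_lt_one (r := 8 * r) (by positivity) (by linarith)).mul_left (4 ^ j))
  have hj : (j : ℝ) + k ≤ 2 ^ j * 2 ^ k := by
    rw [← pow_add]
    exact_mod_cast (Nat.lt_two_pow_self (n := j + k)).le
  calc ((j : ℝ) + k) * ((j + 2 * k).choose k : ℝ) * r ^ k
      ≤ (2 ^ j * 2 ^ k) * (2 ^ j * 4 ^ k) * r ^ k := by
        gcongr; exact choose_le_two_pow_mul j k
    _ = 4 ^ j * (8 * r) ^ k := by
        rw [mul_pow, show (4 : ℝ) = 2 * 2 by norm_num, show (8 : ℝ) = 2 * (2 * 2) by norm_num]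
        simp only [mul_pow]; ring

lemma tsum_mul_catalanPow (h0 : 0 < r) (h1 : r ≤ 1 / 64) {s : ℝ} (hs0 : 0 < s)
    (hs : s ^ 2 = 1 - 4 * r) (j : ℕ) :
    ∑' k : ℕ, ((j : ℝ) + k) * ((j + 2 * k).choose k : ℝ) * r ^ k =
      (2 / (1 + s)) ^ j * (j * (1 + s) / (2 * s ^ 2) + 2 * r / s ^ 3) := by
  have hsum := summable_mul_catalanPow h0.le h1 j
  have hf := summable_catalanPow h0.le h1 j
  have hf1 := summable_catalanPow h0.le h1 (j + 1)
  set A := ∑' k : ℕ, ((j : ℝ) + k) * ((j + 2 * k).choose k : ℝ) * r ^ k with hA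
  have key : A = 4 * r * A + (j * catalanPowSeries r j - r * j * catalanPowSeries r (j + 1)
      + r * (2 - 2 * j) * catalanPowSeries r j) := by
    have hshift : A = j + ∑' k : ℕ, ((j : ℝ) + 1 + k) * ((j + 2 * (k + 1)).choose (k + 1)) *
        r ^ (k + 1) := by
      rw [hA, hsum.tsum_eq_zero_add]
      congr 1
      · simp
      · refine tsum_congr fun k => ?_
        push_cast
        ring
    have hfs : catalanPowSeries r j = 1 + ∑' k : ℕ, ((j + 2 * (k + 1)).choose (k + 1) : ℝ) *
        r ^ (k + 1) := by
      unfold catalanPowSeries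
      rw [hf.tsum_eq_zero_add]
      simp
    have hexp : ∑' k : ℕ, ((j : ℝ) + 1 + k) * ((j + 2 * (k + 1)).choose (k + 1)) * r ^ (k + 1) =
        4 * r * A + (j * (catalanPowSeries r j - 1) - r * j * catalanPowSeries r (j + 1)
      + r * (2 - 2 * j) * catalanPowSeries r j) := by
      have hfs' : catalanPowSeries r j - 1 = ∑' k : ℕ, ((j + 2 * (k + 1)).choose (k + 1) : ℝ) *
        r ^ (k + 1) := by linarith
      rw [hfs', hA]
      unfold catalanPowSeries
      rw [← tsum_mul_left, ← tsum_mul_left, ← tsum_mul_left, ← tsum_mul_left,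
        ← Summable.tsum_sub (((summable_nat_add_iff 1).mpr hf).mul_left _) (hf1.mul_left _),
        ← Summable.tsum_add ((((summable_nat_add_iff 1).mpr hf).mul_left _).sub (hf1.mul_left _))
          (hf.mul_left _),
        ← Summable.tsum_add (hsum.mul_left _)
          (((((summable_nat_add_iff 1).mpr hf).mul_left _).sub (hf1.mul_left _)).add
          (hf.mul_left _))]
      refine tsum_congr fun k => ?_
      rw [mul_choose_shift]
      ring
    rw [hexp] at hshift
    linear_combination hshift
  rw [catalanPowSeries_eq h0 h1 hs0 hs, catalanPowSeries_eq h0 h1 hs0 hs] at key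
  have hr : r = (1 - s ^ 2) / 4 := by linarith
  have h2 : s ^ 2 * A = (2 / (1 + s)) ^ j * (j * (1 + s) / 2 + 2 * r / s) := by
    have : s ^ 2 * A = A - 4 * r * A := by rw [hs]; ring
    rw [this]
    rw [pow_succ] at key
    calc A - 4 * r * A = j * ((2 / (1 + s)) ^ j / s) -
          r * j * ((2 / (1 + s)) ^ j * (2 / (1 + s)) / s) +
          r * (2 - 2 * j) * ((2 / (1 + s)) ^ j / s) := by linear_combination key
      _ = _ := by
        rw [hr]
        field_simp
        ring
  have hs2 : s ^ 2 ≠ 0 := by positivity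
  apply mul_left_cancel₀ hs2
  rw [h2]
  field_simp

end

section

/-- The absolute value of the `m`-th coefficient of the expansion, up to normalisation. -/
noncomputable def coeffSum (α : ℝ) (m : ℕ) : ℝ :=
  ∑ k ∈ Finset.range ((m + 1) / 2 + 1),
    ((m + 1).choose k : ℝ) * ((m + 1 - k : ℕ) : ℝ) / ((m + 1 - 2 * k).factorial : ℝ) *
      α ^ ((m : ℤ) - 2 * k)

/-- The double series underlying the expansion of the main term. -/
noncomputable def doubleTerm (α t : ℝ) (x : ℕ × ℕ) : ℝ :=
  ((x.1 : ℝ) + x.2) * ((x.1 + 2 * x.2).choose x.2 : ℝ) / (x.1.factorial : ℝ) *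
    (-α) ^ x.1 * t ^ (x.1 + 2 * x.2)

variable {α t s : ℝ}

lemma summable_doubleTerm (hα : 0 < α) (ht : 0 < t) (ht1 : t ≤ 1 / 8) :
    Summable (doubleTerm α t) := by
  have h1 : Summable fun j : ℕ => (4 * α * t) ^ j / (j.factorial : ℝ) :=
    Real.summable_pow_div_factorial _
  have h2 : Summable fun k : ℕ => (8 * t ^ 2) ^ k :=
    summable_geometric_of_lt_one (by positivity) (by nlinarith)
  have h3 := h1.mul_of_nonneg h2 (fun j => by positivity) (fun k => by positivity)
  refine Summable.of_norm_bounded h3 fun x => ?_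
  obtain ⟨j, k⟩ := x
  have hj : (j : ℝ) + k ≤ 2 ^ j * 2 ^ k := by
    rw [← pow_add]
    exact_mod_cast (Nat.lt_two_pow_self (n := j + k)).le
  simp only [doubleTerm, norm_mul, norm_div, norm_pow, norm_neg, Real.norm_eq_abs, Nat.abs_cast,
    abs_of_pos hα, abs_of_pos ht]
  rw [abs_of_nonneg (by positivity)]
  calc ((j : ℝ) + k) * ((j + 2 * k).choose k : ℝ) / (j.factorial : ℝ) * α ^ j * t ^ (j + 2 * k)
      ≤ (2 ^ j * 2 ^ k) * (2 ^ j * 4 ^ k) / (j.factorial : ℝ) * α ^ j * t ^ (j + 2 * k) := by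
        gcongr
        exact choose_le_two_pow_mul j k
    _ = _ := by
        rw [show (4 : ℝ) = 2 * 2 by norm_num, show (8 : ℝ) = 2 * (2 * 2) by norm_num, pow_add,
          pow_mul]
        simp only [mul_pow]
        ring

lemma hasSum_doubleTerm (hα : 0 < α) (ht : 0 < t) (ht1 : t ≤ 1 / 8) (hs0 : 0 < s)
    (hs : s ^ 2 = 1 - 4 * t ^ 2) :
    HasSum (doubleTerm α t)
      (exp (-α * ((1 - s) / (2 * t))) * (-α * t / s ^ 2 + 2 * t ^ 2 / s ^ 3)) := by
  have hr0 : 0 < t ^ 2 := by positivity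
  have hr1 : t ^ 2 ≤ 1 / 64 := by nlinarith
  have hsum := summable_doubleTerm hα ht ht1
  have hfib : ∀ j, HasSum (fun k => doubleTerm α t (j, k))
      ((-α * t) ^ j / (j.factorial : ℝ) *
        ((2 / (1 + s)) ^ j * (j * (1 + s) / (2 * s ^ 2) + 2 * t ^ 2 / s ^ 3))) := fun j => by
    have h := (summable_mul_catalanPow hr0.le hr1 j).hasSum
    rw [tsum_mul_catalanPow hr0 hr1 hs0 hs j] at h
    refine (h.mul_left ((-α * t) ^ j / (j.factorial : ℝ))).congr_fun ?_
    intro k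
    simp only [doubleTerm, pow_add, mul_pow, pow_mul]
    ring
  have hV := hsum.hasSum.prod_fiberwise hfib
  set u := (1 - s) / (2 * t) with hu
  have htu : t * (2 / (1 + s)) = u := by
    rw [hu]; field_simp
    linear_combination hs
  have hexp : HasSum (fun j : ℕ => (-α * u) ^ j / (j.factorial : ℝ)) (exp (-α * u)) := by
    rw [Real.exp_eq_exp_ℝ]
    exact NormedSpace.expSeries_div_hasSum_exp (-α * u)
  have hexp1 : HasSum (fun j : ℕ => (j : ℝ) * ((-α * u) ^ j / (j.factorial : ℝ)))
      (-α * u * exp (-α * u)) := by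
    rw [← hasSum_nat_add_iff' 1]
    simp only [sum_range_one, Nat.cast_zero, zero_mul, sub_zero]
    refine (hexp.mul_left (-α * u)).congr_fun fun j => ?_
    rw [Nat.factorial_succ]
    push_cast
    field_simp
    ring
  have hV2 : HasSum (fun j : ℕ => (-α * t) ^ j / (j.factorial : ℝ) *
        ((2 / (1 + s)) ^ j * (j * (1 + s) / (2 * s ^ 2) + 2 * t ^ 2 / s ^ 3)))
      ((1 + s) / (2 * s ^ 2) * (-α * u * exp (-α * u)) + 2 * t ^ 2 / s ^ 3 * exp (-α * u)) := by
    refine ((hexp1.mul_left _).add (hexp.mul_left _)).congr_fun fun j => ?_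
    rw [← htu]
    simp only [mul_pow]
    ring
  have hval := hV.unique hV2
  have hfin := hsum.hasSum
  rw [hval] at hfin
  convert! hfin using 1
  have hus : u * (1 + s) / 2 = t := by
    rw [hu]; field_simp; linear_combination -hs
  rw [← sub_eq_zero]
  have : -α * t = -α * (u * (1 + s) / 2) := by rw [hus]
  rw [this]
  field_simp
  ring

lemma sum_doubleTerm_eq (hα : 0 < α) (m : ℕ) :
    ∑ k ∈ Finset.range ((m + 1) / 2 + 1), doubleTerm α t (m + 1 - 2 * k, k) =
      (-α * t) * ((-1) ^ m * (coeffSum α m * t ^ m)) := by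
  rw [coeffSum, sum_mul, mul_sum, mul_sum]
  refine sum_congr rfl fun k hk => ?_
  have hk2 : 2 * k ≤ m + 1 := by
    have := mem_range.mp hk
    omega
  obtain ⟨j, hj⟩ : ∃ j, m + 1 = j + 2 * k := ⟨m + 1 - 2 * k, by omega⟩
  have e1 : m + 1 - 2 * k = j := by omega
  have e2 : m + 1 - k = j + k := by omega
  have e3 : α ^ ((m : ℤ) - 2 * k) = α ^ j / α := by
    rw [show (m : ℤ) - 2 * k = (j : ℤ) - 1 by omega, zpow_sub_one₀ hα.ne', zpow_natCast]
    rfl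
  have e4 : (-1 : ℝ) ^ m = -(-1) ^ j := by
    have : (-1 : ℝ) ^ (m + 1) = (-1) ^ j := by rw [hj, pow_add, pow_mul]; simp
    rw [pow_succ] at this
    linarith
  simp only [doubleTerm]
  rw [e1, e2, e3, e4, ← hj, neg_pow α, pow_succ]
  push_cast
  field_simp

/-- The convergent expansion of the main term. -/
theorem hasSum_coeffSum (hα : 0 < α) (ht : 0 < t) (ht1 : t ≤ 1 / 8) (hs0 : 0 < s)
    (hs : s ^ 2 = 1 - 4 * t ^ 2) :
    HasSum (fun m : ℕ => (-1) ^ m * (coeffSum α m * t ^ m))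
      (exp (-α * ((1 - s) / (2 * t))) * (1 / s ^ 2 - 2 * t / (α * s ^ 3))) := by
  have h := hasSum_doubleTerm hα ht ht1 hs0 hs
  let ι : ℕ × ℕ → ℕ × ℕ := fun x => (x.1 + 2 * x.2, x.2)
  have hι : Function.Injective ι := by
    rintro ⟨a, b⟩ ⟨c, d⟩ h
    simp only [ι, Prod.mk.injEq] at h ⊢
    omega
  let W : ℕ × ℕ → ℝ := fun x => if 2 * x.2 ≤ x.1 then doubleTerm α t (x.1 - 2 * x.2, x.2) else 0
  have hW : W ∘ ι = doubleTerm α t := by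
    ext ⟨j, k⟩
    simp [W, ι]
  have hW0 : ∀ x ∉ Set.range ι, W x = 0 := by
    rintro ⟨M, k⟩ hx
    simp only [W]
    rw [if_neg]
    intro hle
    exact hx ⟨(M - 2 * k, k), by simp only [ι, Prod.mk.injEq, and_true]; omega⟩
  rw [← hW, hι.hasSum_iff hW0] at h
  have hfib : ∀ M, HasSum (fun k => W (M, k))
      (∑ k ∈ Finset.range (M / 2 + 1), doubleTerm α t (M - 2 * k, k)) := fun M => by
    have : ∑ k ∈ Finset.range (M / 2 + 1), doubleTerm α t (M - 2 * k, k) =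
        ∑ k ∈ Finset.range (M / 2 + 1), W (M, k) := by
      refine sum_congr rfl fun k hk => ?_
      have := mem_range.mp hk
      simp only [W]
      rw [if_pos (by omega)]
    rw [this]
    refine hasSum_sum_of_ne_finset_zero fun k hk => ?_
    simp only [W]
    rw [if_neg]
    intro hle
    exact hk (mem_range.mpr (by omega))
  have h2 := h.prod_fiberwise hfib
  rw [← hasSum_nat_add_iff' 1] at h2
  simp only [sum_doubleTerm_eq hα] at h2
  have hne : -α * t ≠ 0 := by
    have : 0 < α * t := by positivity
    linarith
  have h3 := h2.mul_left (-α * t)⁻¹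
  simp only [inv_mul_cancel_left₀ hne] at h3
  convert! h3 using 1
  simp [doubleTerm]
  field_simp
  ring

end

section

variable {α t s : ℝ}

lemma coeffSum_eq (hα : 0 < α) (m : ℕ) : coeffSum α m =
    (m + 1) * ∑ k ∈ Finset.range ((m + 1) / 2 + 1),
      (m.choose k : ℝ) / ((m + 1 - 2 * k).factorial : ℝ) * (α ^ (m + 1 - 2 * k) / α) := by
  rw [coeffSum, mul_sum]
  refine sum_congr rfl fun k hk => ?_
  have hk2 : 2 * k ≤ m + 1 := by
    have := mem_range.mp hk
    omega
  have e3 : α ^ ((m : ℤ) - 2 * k) = α ^ (m + 1 - 2 * k) / α := by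
    rw [show (m : ℤ) - 2 * k = ((m + 1 - 2 * k : ℕ) : ℤ) - 1 by omega, zpow_sub_one₀ hα.ne',
      zpow_natCast]
    rfl
  have h3 := Nat.choose_mul_succ_eq m k
  have h3' : ((m.choose k : ℕ) : ℝ) * (m + 1) =
      ((m + 1).choose k) * ((m + 1 - k : ℕ) : ℝ) := by exact_mod_cast h3
  rw [e3, ← h3']
  ring

lemma coeffSum_even (hα : 0 < α) (M : ℕ) : coeffSum α (2 * M) =
    (2 * M + 1) * ∑ i ∈ Finset.range (M + 1),
      ((2 * M).choose (M - i) : ℝ) / ((2 * i + 1).factorial : ℝ) * α ^ (2 * i) := by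
  rw [coeffSum_eq hα, show (2 * M + 1) / 2 + 1 = M + 1 by omega, ← sum_range_reflect]
  push_cast
  congr 1
  refine sum_congr rfl fun k hk => ?_
  have := mem_range.mp hk
  rw [show 2 * M + 1 - 2 * (M - k) = 2 * k + 1 by omega,
    pow_succ]
  field_simp

lemma coeffSum_odd (hα : 0 < α) (M : ℕ) : coeffSum α (2 * M + 1) =
    (2 * M + 2) * ∑ i ∈ Finset.range (M + 2),
      ((2 * M + 1).choose (M + 1 - i) : ℝ) / ((2 * i).factorial : ℝ) * (α ^ (2 * i) / α) := by
  rw [coeffSum_eq hα, show (2 * M + 1 + 1) / 2 + 1 = M + 2 by omega, ← sum_range_reflect]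
  push_cast
  congr 1
  · ring
  refine sum_congr rfl fun k hk => ?_
  have := mem_range.mp hk
  rw [show 2 * M + 1 + 1 - 2 * (M + 1 - k) = 2 * k by omega]

lemma sum_range_le_cosh (x : ℝ) (N : ℕ) :
    ∑ i ∈ Finset.range N, x ^ (2 * i) / ((2 * i).factorial : ℝ) ≤ cosh x :=
  sum_le_hasSum _ (fun i _ => by rw [pow_mul]; positivity) (Real.hasSum_cosh x)

lemma coeffSum_even_le (hα : 0 < α) (M : ℕ) :
    coeffSum α (2 * M) ≤ (2 * M + 1) * ((2 * M).choose M * cosh α) := by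
  rw [coeffSum_even hα]
  gcongr
  refine le_trans ?_ (mul_le_mul_of_nonneg_left (sum_range_le_cosh α (M + 1)) (by positivity))
  rw [mul_sum]
  refine sum_le_sum fun i _ => ?_
  rw [div_mul_eq_mul_div, mul_div_assoc]
  have h1 : (2 * M).choose (M - i) ≤ (2 * M).choose M := by
    simpa using Nat.choose_le_middle (M - i) (2 * M)
  have h2 : (2 * i).factorial ≤ (2 * i + 1).factorial := Nat.factorial_le (by omega)
  gcongr

lemma le_coeffSum_even (hα : 0 < α) (M : ℕ) :
    (2 * M + 1) * ((2 * M).choose M : ℝ) ≤ coeffSum α (2 * M) := by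
  rw [coeffSum_even hα, sum_range_succ']
  simp only [mul_zero, Nat.sub_zero, zero_add, Nat.factorial_one, Nat.cast_one, div_one, pow_zero,
    mul_one]
  gcongr
  have : 0 ≤ ∑ k ∈ Finset.range M, ((2 * M).choose (M - (k + 1)) : ℝ) /
    ((2 * (k + 1) + 1).factorial : ℝ) * α ^ (2 * (k + 1)) := sum_nonneg fun i _ => by positivity
  linarith

lemma coeffSum_odd_le (hα : 0 < α) (M : ℕ) :
    coeffSum α (2 * M + 1) ≤ (2 * M + 2) * ((2 * M + 1).choose M * (cosh α / α)) := by
  rw [coeffSum_odd hα]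
  gcongr
  have := mul_le_mul_of_nonneg_left (sum_range_le_cosh α (M + 2))
    (show 0 ≤ ((2 * M + 1).choose M : ℝ) / α by positivity)
  refine le_trans ?_ (this.trans_eq (by ring))
  rw [mul_sum]
  refine sum_le_sum fun i _ => ?_
  have h1 : (2 * M + 1).choose (M + 1 - i) ≤ (2 * M + 1).choose M := by
    have := Nat.choose_le_middle (M + 1 - i) (2 * M + 1)
    rwa [show (2 * M + 1) / 2 = M by omega] at this
  calc ((2 * M + 1).choose (M + 1 - i) : ℝ) / ((2 * i).factorial : ℝ) * (α ^ (2 * i) / α)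
      ≤ ((2 * M + 1).choose M : ℝ) / ((2 * i).factorial : ℝ) * (α ^ (2 * i) / α) := by gcongr
    _ = _ := by ring

lemma le_coeffSum_odd (hα : 0 < α) (M : ℕ) :
    (2 * M + 2) * (((2 * M + 1).choose M : ℝ) / α) ≤ coeffSum α (2 * M + 1) := by
  rw [coeffSum_odd hα, sum_range_succ', Nat.sub_zero, Nat.choose_symm_half]
  simp only [mul_zero, Nat.factorial_zero, Nat.cast_one, div_one, pow_zero]
  gcongr
  have : 0 ≤ ∑ k ∈ Finset.range (M + 1), ((2 * M + 1).choose (M + 1 - (k + 1)) : ℝ) /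
    ((2 * (k + 1)).factorial : ℝ) * (α ^ (2 * (k + 1)) / α) := sum_nonneg fun i _ => by positivity
  linarith [mul_one_div ((2 * M + 1).choose M : ℝ) α]

lemma cosh_le_of_le_one (hα : 0 < α) (hα1 : α ≤ 1) : cosh α ≤ 7 / 4 := by
  have h1 := Real.cosh_le_exp_half_sq α
  have h2 : exp (α ^ 2 / 2) ≤ exp (1 / 2) := by
    apply exp_le_exp.mpr; nlinarith
  have h3 : exp (1 / 2) ^ 2 ≤ (7 / 4) ^ 2 := by
    rw [← Real.exp_nat_mul]
    have := Real.exp_one_lt_d9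
    norm_num
    linarith
  have := (le_abs_self _).trans (abs_le_of_sq_le_sq h3 (by norm_num))
  linarith

lemma antitone_coeffSum_mul_pow (hα : 1 / 2 ≤ α) (hα1 : α ≤ 1) (ht : 0 < t) (ht1 : t ≤ 1 / 8) :
    Antitone fun m : ℕ => coeffSum α m * t ^ m := by
  have hα0 : 0 < α := by linarith
  have hc := cosh_le_of_le_one hα0 hα1
  have hc0 := Real.cosh_pos α
  have key : ∀ m, 0 ≤ coeffSum α m ∧ coeffSum α (m + 1) ≤ 8 * coeffSum α m := by
    intro m
    rcases Nat.even_or_odd' m with ⟨M, rfl | rfl⟩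
    · have h1 := le_coeffSum_even hα0 M
      have h2 := coeffSum_odd_le hα0 M
      have h3 : ((2 * M).choose M : ℝ) * (2 * M + 1) = ((2 * M + 1).choose M) * (M + 1) := by
        have := Nat.choose_mul_succ_eq (2 * M) M
        rw [show 2 * M + 1 - M = M + 1 by omega] at this
        exact_mod_cast this
      refine ⟨le_trans (by positivity) h1, h2.trans ?_⟩
      have h4 : cosh α / α ≤ 4 := by
        rw [div_le_iff₀ hα0]; linarith
      calc (2 * M + 2) * (((2 * M + 1).choose M : ℝ) * (cosh α / α))
          ≤ (2 * M + 2) * (((2 * M + 1).choose M : ℝ) * 4) := by gcongr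
        _ = 8 * ((2 * M + 1) * ((2 * M).choose M : ℝ)) := by linear_combination (-8) * h3
        _ ≤ _ := by gcongr
    · have h1 := le_coeffSum_odd hα0 M
      have h2 := coeffSum_even_le hα0 (M + 1)
      rw [show 2 * (M + 1) = 2 * M + 1 + 1 by ring] at h2
      have h3 : ((2 * M + 1 + 1).choose (M + 1) : ℝ) = 2 * ((2 * M + 1).choose M) := by
        rw [Nat.choose_succ_succ, Nat.succ_eq_add_one, Nat.choose_symm_half]
        push_cast
        ring
      refine ⟨le_trans (by positivity) h1, h2.trans ?_⟩
      rw [h3]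
      push_cast
      have h5 : ((2 * M + 1).choose M : ℝ) ≤ ((2 * M + 1).choose M : ℝ) / α := by
        rw [le_div_iff₀ hα0]
        nlinarith [show (0 : ℝ) ≤ ((2 * M + 1).choose M : ℝ) by positivity]
      calc (2 * ((M : ℝ) + 1) + 1) * (2 * ((2 * M + 1).choose M : ℝ) * cosh α)
          ≤ (2 * (2 * (M : ℝ) + 2)) * (2 * ((2 * M + 1).choose M : ℝ) * (7 / 4)) := by
            gcongr
            linarith [show (0 : ℝ) ≤ M by positivity]
        _ ≤ 8 * ((2 * M + 2) * ((2 * M + 1).choose M : ℝ)) := by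
            nlinarith [show (0 : ℝ) ≤ (2 * M + 2) * ((2 * M + 1).choose M : ℝ) by positivity]
        _ ≤ 8 * ((2 * M + 2) * (((2 * M + 1).choose M : ℝ) / α)) := by gcongr
        _ ≤ _ := by gcongr
  refine antitone_nat_of_succ_le fun m => ?_
  have h0 := (key m).1
  calc coeffSum α (m + 1) * t ^ (m + 1) ≤ (8 * coeffSum α m) * t ^ (m + 1) := by
        gcongr; exact (key m).2
    _ = coeffSum α m * t ^ m * (8 * t) := by ring
    _ ≤ coeffSum α m * t ^ m * 1 := by gcongr; linarith
    _ = _ := mul_one _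

/-- The odd truncations of the expansion overestimate the main term by at most the next term. -/
lemma expansion_remainder (hα : 1 / 2 ≤ α) (hα1 : α ≤ 1) (ht : 0 < t) (ht1 : t ≤ 1 / 8)
    (hs0 : 0 < s) (hs : s ^ 2 = 1 - 4 * t ^ 2) (N : ℕ) :
    exp (-α * ((1 - s) / (2 * t))) * (1 / s ^ 2 - 2 * t / (α * s ^ 3)) -
      ∑ m ∈ Finset.range (2 * N + 1), (-1) ^ m * (coeffSum α m * t ^ m) ∈
    Set.Icc (-(coeffSum α (2 * N + 1) * t ^ (2 * N + 1))) 0 := by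
  have hα0 : 0 < α := by linarith
  have h := (hasSum_coeffSum hα0 ht ht1 hs0 hs).tendsto_sum_nat
  have ha := antitone_coeffSum_mul_pow hα hα1 ht ht1
  have h1 := ha.tendsto_le_alternating_series h N
  have h2 := ha.alternating_series_le_tendsto h (N + 1)
  have e : (-1 : ℝ) ^ (2 * N + 1) = -1 := by rw [pow_succ, pow_mul]; norm_num
  rw [show 2 * (N + 1) = 2 * N + 1 + 1 by ring, sum_range_succ, e] at h2
  constructor <;> linarith

lemma centralBinom_sq_le (M : ℕ) :
    ((M.centralBinom : ℝ) / 4 ^ M) ^ 2 * (π * (M + 1 / 4)) ≤ 1 := by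
  set f : ℕ → ℝ := fun M => ((M.centralBinom : ℝ) / 4 ^ M) ^ 2 * (π * (M + 1 / 4)) with hf
  have hmono : Monotone f := by
    refine monotone_nat_of_le_succ fun n => ?_
    have h : (n + 1 : ℝ) * (n + 1).centralBinom = 2 * (2 * n + 1) * n.centralBinom := by
      exact_mod_cast Nat.succ_mul_centralBinom_succ n
    have h' : ((n + 1).centralBinom : ℝ) / 4 ^ (n + 1) =
        (n.centralBinom / 4 ^ n) * ((2 * n + 1) / (2 * n + 2)) := by
      field_simp
      rw [pow_succ]
      linear_combination 2 * 4 ^ n * h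
    simp only [hf]
    rw [h', mul_pow, mul_assoc]
    refine mul_le_mul_of_nonneg_left ?_ (by positivity)
    push_cast
    rw [div_pow, div_mul_eq_mul_div, le_div_iff₀ (by positivity)]
    nlinarith [pi_pos]
  have hW : ∀ n, f n = π * (1 / Real.Wallis.W n) * ((n + 1 / 4) / (2 * n + 1)) := by
    intro n
    simp only [hf]
    have h2 : ((2 * n).choose n : ℝ) = ((2 * n).factorial : ℝ) / (n.factorial : ℝ) ^ 2 := by
      rw [Nat.cast_choose ℝ (by omega : n ≤ 2 * n), show 2 * n - n = n by omega, sq]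
    rw [Real.Wallis.W_eq_factorial_ratio, Nat.centralBinom_eq_two_mul_choose, h2,
      show (2 : ℝ) ^ (4 * n) = (4 ^ n) ^ 2 by
        rw [show (4 : ℝ) = 2 ^ 2 by norm_num, ← pow_mul, ← pow_mul]
        congr 1
        ring]
    have := Nat.factorial_pos n
    have := Nat.factorial_pos (2 * n)
    field_simp
  have hlim : Tendsto f atTop (𝓝 1) := by
    have h1 := Real.Wallis.tendsto_W_nhds_pi_div_two
    have h2 : Tendsto (fun n : ℕ => ((n : ℝ) + 1 / 4) / (2 * n + 1)) atTop (𝓝 (1 / 2)) := by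
      have : (fun n : ℕ => ((n : ℝ) + 1 / 4) / (2 * n + 1)) =
          fun n : ℕ => 1 / 2 - (1 / 4) * (2 * (n : ℝ) + 1)⁻¹ := by
        ext n
        field_simp
        ring
      rw [this]
      have h3 : Tendsto (fun n : ℕ => 2 * (n : ℝ) + 1) atTop atTop :=
        tendsto_atTop_add_const_right _ _
          (tendsto_natCast_atTop_atTop.const_mul_atTop (by norm_num))
      have h4 := (h3.inv_tendsto_atTop.const_mul (1 / 4)).const_sub (1 / 2)
      rwa [mul_zero, sub_zero] at h4
    have h3 := ((h1.inv₀ (by positivity)).const_mul π).mul h2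
    have e : π * (π / 2)⁻¹ * (1 / 2) = 1 := by
      field_simp
    rw [e] at h3
    refine h3.congr fun n => ?_
    simp only [hW, one_div]
  exact hmono.ge_of_tendsto hlim M

/-- The next omitted coefficient. -/
lemma coeffSum_odd_bound (hα : 0 < α) (N : ℕ) :
    coeffSum α (2 * N + 1) / 2 ^ (2 * N + 1) ≤
      cosh α / α * (2 * (N + 1) / √(π * (N + 5 / 4))) := by
  have h := coeffSum_odd_le hα N
  have hw := centralBinom_sq_le (N + 1)
  have h3 : ((N + 1).centralBinom : ℝ) = 2 * ((2 * N + 1).choose N) := by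
    rw [Nat.centralBinom, show 2 * (N + 1) = 2 * N + 1 + 1 by ring,
      Nat.choose_succ_succ, Nat.succ_eq_add_one, Nat.choose_symm_half]
    push_cast
    ring
  have hpos : 0 < π * (N + 5 / 4) := by positivity
  have hcb : ((N + 1).centralBinom : ℝ) / 4 ^ (N + 1) ≤ 1 / √(π * (N + 5 / 4)) := by
    rw [le_div_iff₀ (by positivity)]
    refine (le_abs_self _).trans (abs_le_of_sq_le_sq (b := 1) ?_ (by norm_num))
    rw [mul_pow, Real.sq_sqrt hpos.le, one_pow]
    push_cast at hw
    convert! hw using 3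
    ring
  have hc0 := Real.cosh_pos α
  calc coeffSum α (2 * N + 1) / 2 ^ (2 * N + 1)
      ≤ (2 * N + 2) * ((2 * N + 1).choose N * (cosh α / α)) / 2 ^ (2 * N + 1) := by gcongr
    _ = cosh α / α * (2 * (N + 1) * (((N + 1).centralBinom : ℝ) / 4 ^ (N + 1))) := by
        rw [h3, show (4 : ℝ) = 2 ^ 2 by norm_num, ← pow_mul,
          show 2 * (N + 1) = 2 * N + 1 + 1 by ring, pow_succ _ (2 * N + 1)]
        field_simp
        try ring
    _ ≤ cosh α / α * (2 * (N + 1) * (1 / √(π * (N + 5 / 4)))) := by gcongr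
    _ = _ := by ring

end

open scoped PowerSeries.WithPiTopology in
/-- Euler's generating function identity for the partition numbers. -/
lemma powerSeries_card_mul_pentagonalSeries :
    (PowerSeries.mk fun n => (Fintype.card (Nat.Partition n) : ℤ)) *
      PowerSeries.pentagonalSeries ℤ = 1 := by
  have h1 := Nat.Partition.hasProd_powerSeriesMk_card_restricted ℤ (fun _ => True)
  have h2 := PowerSeries.WithPiTopology.hasProd_one_sub_X_pow ℤ
  have h3 := h1.mul h2
  have e : (fun i => (if True then ∑' j : ℕ, (PowerSeries.X : PowerSeries ℤ) ^ ((i + 1) * j) else 1)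
      * (1 - PowerSeries.X ^ (i + 1))) = fun _ => 1 := by
    ext1 i
    simp_rw [if_true, pow_mul]
    exact PowerSeries.WithPiTopology.tsum_pow_mul_one_sub_of_constantCoeff_eq_zero (by simp)
  simp only [e] at h3
  have h4 := h3.unique hasProd_one
  simpa [Nat.Partition.restricted] using h4

lemma antidiagonal_pentagonal (n : ℕ) :
    ∑ x ∈ antidiagonal n, (Fintype.card (Nat.Partition x.1) : ℤ) *
      (PowerSeries.pentagonalSeries ℤ).coeff x.2 = if n = 0 then 1 else 0 := by
  have h := congrArg (PowerSeries.coeff n) powerSeries_card_mul_pentagonalSeries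
  simpa [PowerSeries.coeff_mul, PowerSeries.coeff_one] using h

/-- The Euler function. -/
noncomputable def eulerProd (q : ℂ) : ℂ := ∏' n : ℕ, (1 - q ^ (n + 1))

section
variable {q : ℂ}

lemma summable_norm_pow (hq : ‖q‖ < 1) (k : ℕ) : Summable fun n : ℕ => ‖-q ^ (n + k + 1)‖ := by
  simp_rw [norm_neg, norm_pow]
  have := (summable_nat_add_iff (k + 1)).mpr (summable_geometric_of_lt_one (norm_nonneg q) hq)
  exact this

lemma eulerProd_ne_zero (hq : ‖q‖ < 1) : eulerProd q ≠ 0 := by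
  rw [eulerProd]
  simp_rw [sub_eq_add_neg]
  refine tprod_one_add_ne_zero_of_summable (fun n => ?_) (summable_norm_pow hq 0)
  rw [← sub_eq_add_neg, sub_ne_zero]
  intro h
  have : ‖q ^ (n + 1)‖ < 1 := by
    rw [norm_pow]
    exact pow_lt_one₀ (norm_nonneg q) hq (by omega)
  rw [← h] at this
  simp at this

lemma norm_prod_one_sub_le (hq : ‖q‖ < 1) (k n : ℕ) :
    ‖∏ i ∈ Finset.range n, (1 - q ^ (k + i + 1))‖ ≤ exp (1 - ‖q‖)⁻¹ := by
  have h := tsum_geometric_of_lt_one (norm_nonneg q) hq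
  have hs := summable_geometric_of_lt_one (norm_nonneg q) hq
  rw [norm_prod]
  calc ∏ i ∈ Finset.range n, ‖1 - q ^ (k + i + 1)‖
      ≤ ∏ i ∈ Finset.range n, (1 + ‖q‖ ^ i) := by
        refine prod_le_prod (fun i _ => norm_nonneg _) fun i _ => ?_
        refine (norm_sub_le _ _).trans ?_
        rw [norm_one, norm_pow]
        gcongr 1 + ?_
        exact pow_le_pow_of_le_one (norm_nonneg q) hq.le (by omega)
    _ ≤ exp (∑ i ∈ Finset.range n, ‖q‖ ^ i) :=
        Real.prod_one_add_le_exp_sum _ fun i => by positivity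
    _ ≤ _ := by
        rw [← h]
        exact exp_le_exp.mpr (hs.sum_le_tsum _ fun i _ => by positivity)

lemma norm_pow_mul_prod_le (hq : ‖q‖ < 1) (k n : ℕ) :
    ‖q ^ ((k + 1) * n) * ∏ i ∈ Finset.range (n + 1), (1 - q ^ (k + i + 1))‖ ≤
      ‖q‖ ^ n * exp (1 - ‖q‖)⁻¹ := by
  rw [norm_mul, norm_pow]
  exact mul_le_mul (pow_le_pow_of_le_one (norm_nonneg q) hq.le (by nlinarith))
    (norm_prod_one_sub_le hq k (n + 1)) (norm_nonneg _) (by positivity)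

lemma norm_coeff_pentagonalSeries_le (n : ℕ) :
    ‖((PowerSeries.pentagonalSeries ℤ).coeff n : ℂ)‖ ≤ 1 := by
  by_cases h : n ∈ Set.range pentagonal
  · obtain ⟨k, rfl⟩ := h
    rw [PowerSeries.coeff_pentagonalSeries_pentagonal]
    rcases Int.even_or_odd k with h | h
    · simp [Int.negOnePow_even k h]
    · simp [Int.negOnePow_odd k h]
  · simp [PowerSeries.coeff_pentagonalSeries_eq_zero ℤ h]

lemma summable_pentagonal_terms (hq : ‖q‖ < 1) :
    Summable fun n => ((PowerSeries.pentagonalSeries ℤ).coeff n : ℂ) * q ^ n := by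
  refine Summable.of_norm_bounded (summable_geometric_of_lt_one (norm_nonneg q) hq) fun n => ?_
  rw [norm_mul, norm_pow]
  exact mul_le_of_le_one_left (by positivity) (norm_coeff_pentagonalSeries_le n)

lemma hasSum_eulerProd (hq : ‖q‖ < 1) :
    HasSum (fun n => ((PowerSeries.pentagonalSeries ℤ).coeff n : ℂ) * q ^ n) (eulerProd q) := by
  have h1 := (summable_pentagonal_terms hq).hasSum
  have h2 := (pentagonal_injective.hasSum_iff (fun n hn => by
    simp [PowerSeries.coeff_pentagonalSeries_eq_zero ℤ hn])).mpr h1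
  rw [← neg_injective.hasSum_iff (fun x hx ↦ by absurd hx; use -x; simp)] at h2
  have h3 : HasSum (fun k : ℕ ↦ (-1 : ℂ) ^ k * (q ^ pentagonal (-k) -
      q ^ pentagonal (k + 1)))
      (∑' n, ((PowerSeries.pentagonalSeries ℤ).coeff n : ℂ) * q ^ n) := by
    convert! h2.nat_add_neg_add_one using 2 with k
    simp_rw [Function.comp_apply, neg_neg, PowerSeries.coeff_pentagonalSeries_pentagonal,
      Int.negOnePow_add]
    simp
    ring
  rw [eulerProd, Pentagonal.tprod_one_sub_pow _ _ _ h3.summable, h3.tsum_eq]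
  · exact h1
  · have hc : ∀ k : ℕ, ‖∑' (n : ℕ), q ^ ((k + 1) * n) * ∏ i ∈ Finset.range (n + 1),
        (1 - q ^ (k + i + 1))‖ ≤ (1 - ‖q‖)⁻¹ * exp (1 - ‖q‖)⁻¹ := fun k =>
      tsum_of_norm_bounded ((hasSum_geometric_of_lt_one (norm_nonneg q) hq).mul_right _)
        (norm_pow_mul_prod_le hq k)
    refine squeeze_zero_norm (a := fun k => ‖q‖ ^ k * ((1 - ‖q‖)⁻¹ * exp (1 - ‖q‖)⁻¹))
      (fun k => ?_) ?_
    · rw [norm_mul]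
      gcongr
      · rw [norm_mul, norm_pow, norm_neg, norm_one, one_pow, one_mul, norm_pow]
        refine pow_le_pow_of_le_one (norm_nonneg q) hq.le ?_
        rw [Nat.le_div_iff_mul_le (by norm_num)]
        nlinarith
      · exact hc k
    · simpa using (tendsto_pow_atTop_nhds_zero_of_lt_one (norm_nonneg q) hq).mul_const
        ((1 - ‖q‖)⁻¹ * exp (1 - ‖q‖)⁻¹)
  · exact tendsto_pow_atTop_nhds_zero_of_norm_lt_one hq
  · exact fun k => Summable.of_norm_bounded
      ((summable_geometric_of_lt_one (norm_nonneg q) hq).mul_right _) (norm_pow_mul_prod_le hq k)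
  · intro k
    simp_rw [sub_eq_add_neg]
    exact multipliable_one_add_of_summable (summable_norm_pow hq k)

end

lemma differentiableAt_eulerProd {q : ℂ} (hq : ‖q‖ < 1) : DifferentiableAt ℂ eulerProd q := by
  obtain ⟨r, hqr, hr⟩ := exists_between hq
  have hr0 : 0 ≤ r := (norm_nonneg q).trans hqr.le
  have hd : DifferentiableOn ℂ (fun z => ∑' n, ((PowerSeries.pentagonalSeries ℤ).coeff n : ℂ) * z ^ n)
      (Metric.ball 0 r) := by
    refine Complex.differentiableOn_tsum_of_summable_norm (summable_geometric_of_lt_one hr0 hr)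
      (fun n => by fun_prop) Metric.isOpen_ball fun n z hz => ?_
    rw [norm_mul, norm_pow]
    rw [mem_ball_zero_iff] at hz
    calc _ ≤ 1 * r ^ n := by
          gcongr
          exact norm_coeff_pentagonalSeries_le n
      _ = _ := one_mul _
  have hmem : Metric.ball (0 : ℂ) r ∈ 𝓝 q := Metric.isOpen_ball.mem_nhds (by simpa using hqr)
  refine (hd.differentiableAt hmem).congr_of_eventuallyEq ?_
  filter_upwards [hmem] with z hz
  exact (hasSum_eulerProd ((mem_ball_zero_iff.mp hz).trans hr)).tsum_eq.symm

/-- A power series vanishing near the origin has zero coefficients. -/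
lemma eq_of_hasSum_pow {a b : ℕ → ℂ} {f : ℂ → ℂ} {r : ℝ} (hr : 0 < r)
    (ha : ∀ z : ℂ, ‖z‖ < r → HasSum (fun n => a n * z ^ n) (f z))
    (hb : ∀ z : ℂ, ‖z‖ < r → HasSum (fun n => b n * z ^ n) (f z)) : a = b := by
  have key : ∀ c : ℕ → ℂ, (∀ z : ℂ, ‖z‖ < r → HasSum (fun n => c n * z ^ n) (f z)) →
      HasFPowerSeriesAt f (FormalMultilinearSeries.ofScalars ℂ c) 0 := by
    intro c hc
    rw [hasFPowerSeriesAt_iff']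
    filter_upwards [Metric.ball_mem_nhds (0 : ℂ) hr] with z hz
    convert! hc z (by simpa using hz) using 2 with n
    rw [FormalMultilinearSeries.coeff_ofScalars, sub_zero, smul_eq_mul, mul_comm]
  have h := (key a ha).eq_formalMultilinearSeries (key b hb)
  exact FormalMultilinearSeries.ofScalars_series_injective ℂ ℂ h

/-- The generating function of the partition numbers converges on the unit disc. -/
lemma hasSum_card_partition {q : ℂ} (hq : ‖q‖ < 1) :
    HasSum (fun n => (Fintype.card (Nat.Partition n) : ℂ) * q ^ n) (eulerProd q)⁻¹ := by
  obtain ⟨r, hqr, hr⟩ := exists_between hq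
  have hr0 : 0 < r := (norm_nonneg q).trans_lt hqr
  have hd : DifferentiableOn ℂ (fun z => (eulerProd z)⁻¹) (Metric.closedBall 0 r) := by
    intro z hz
    have hz1 : ‖z‖ < 1 := (mem_closedBall_zero_iff.mp hz).trans_lt hr
    exact ((differentiableAt_eulerProd hz1).inv (eulerProd_ne_zero hz1)).differentiableWithinAt
  lift r to NNReal using hr0.le
  have hF := hd.hasFPowerSeriesOnBall (by exact_mod_cast hr0)
  set b : ℕ → ℂ := fun n => (cauchyPowerSeries (fun z => (eulerProd z)⁻¹) 0 r).coeff n with hb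
  have hsum : ∀ z : ℂ, ‖z‖ < r → HasSum (fun n => b n * z ^ n) (eulerProd z)⁻¹ := by
    intro z hz
    have := hF.hasSum (y := z) (by
      rw [Metric.mem_eball, edist_zero_right, enorm_eq_nnnorm]
      exact_mod_cast hz)
    simp only [zero_add, FormalMultilinearSeries.apply_eq_pow_smul_coeff, smul_eq_mul] at this
    simpa only [mul_comm] using this
  set e : ℕ → ℂ := fun n => ((PowerSeries.pentagonalSeries ℤ).coeff n : ℂ) with he
  have hprod : ∀ z : ℂ, ‖z‖ < r →
      HasSum (fun n => (∑ x ∈ antidiagonal n, b x.1 * e x.2) * z ^ n) 1 := by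
    intro z hz
    have hz1 : ‖z‖ < 1 := hz.trans hr
    have h1 := (hsum z hz).summable.norm
    have h2 := (summable_pentagonal_terms hz1).norm
    have h3 := summable_norm_sum_mul_antidiagonal_of_summable_norm h1 h2
    have h4 := tsum_mul_tsum_eq_tsum_sum_antidiagonal_of_summable_norm h1 h2
    rw [(hsum z hz).tsum_eq, (hasSum_eulerProd hz1).tsum_eq,
      inv_mul_cancel₀ (eulerProd_ne_zero hz1)] at h4
    rw [h4]
    convert! h3.of_norm.hasSum using 2 with n
    rw [sum_mul]
    refine sum_congr rfl fun x hx => ?_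
    rw [← mem_antidiagonal.mp hx, pow_add]
    ring
  have hone : ∀ z : ℂ, ‖z‖ < r → HasSum (fun n => (if n = 0 then 1 else 0) * z ^ n) 1 := by
    intro z hz
    convert! hasSum_ite_eq (0 : ℕ) (1 : ℂ) using 2 with n
    split_ifs with h <;> simp [h]
  have hcoeff := eq_of_hasSum_pow hr0 hprod hone
  have hb1 : PowerSeries.mk b * PowerSeries.mk e = 1 := by
    ext n
    rw [PowerSeries.coeff_mul, PowerSeries.coeff_one]
    simpa using congrFun hcoeff n
  have hp1 : PowerSeries.mk (fun n => (Fintype.card (Nat.Partition n) : ℂ)) * PowerSeries.mk e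
      = 1 := by
    ext n
    rw [PowerSeries.coeff_mul, PowerSeries.coeff_one]
    simp only [PowerSeries.coeff_mk, he]
    exact_mod_cast congrArg (fun x : ℤ => (x : ℂ)) (antidiagonal_pentagonal n)
  have hbp : PowerSeries.mk (fun n => (Fintype.card (Nat.Partition n) : ℂ)) =
      PowerSeries.mk b := by
    refine mul_right_cancel₀ (b := PowerSeries.mk e) ?_ (hp1.trans hb1.symm)
    intro h
    rw [h, mul_zero] at hb1
    exact zero_ne_one hb1
  have hbp' : ∀ n, (Fintype.card (Nat.Partition n) : ℂ) = b n := fun n => by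
    simpa using congrArg (PowerSeries.coeff n) hbp
  simp_rw [hbp']
  exact hsum q hqr

lemma norm_cexp_two_pi (z : ℂ) : ‖Complex.exp (2 * π * Complex.I * z)‖ = exp (-(2 * π * z.im)) := by
  rw [Complex.norm_exp]
  congr 1
  simp [mul_assoc]

lemma norm_cexp_lt_one {z : ℂ} (hz : 0 < z.im) : ‖Complex.exp (2 * π * Complex.I * z)‖ < 1 := by
  rw [norm_cexp_two_pi, exp_lt_one_iff]
  have := pi_pos
  have : 0 < 2 * π * z.im := by positivity
  linarith

lemma integral_cexp_two_pi (k : ℤ) (y : ℝ) :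
    ∫ x in (-1 / 2 : ℝ)..(1 / 2), Complex.exp (2 * π * Complex.I * k * (x + y * Complex.I)) =
      if k = 0 then 1 else 0 := by
  split_ifs with hk
  · subst hk
    norm_num
  · have hc : 2 * π * Complex.I * k ≠ 0 := by
      have : (k : ℂ) ≠ 0 := by exact_mod_cast hk
      simp [Real.pi_ne_zero, this]
    have e : ∀ x : ℝ, Complex.exp (2 * π * Complex.I * k * (x + y * Complex.I)) =
        Complex.exp (2 * π * Complex.I * k * (y * Complex.I)) *
          Complex.exp (2 * π * Complex.I * k * x) := by
      intro x
      rw [← Complex.exp_add]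
      congr 1
      ring
    simp_rw [e]
    rw [intervalIntegral.integral_const_mul, integral_exp_mul_complex hc]
    have h1 : Complex.exp (2 * π * Complex.I * k * ((1 / 2 : ℝ) : ℂ)) =
        Complex.exp (2 * π * Complex.I * k * ((-1 / 2 : ℝ) : ℂ)) := by
      rw [Complex.exp_eq_exp_iff_exists_int]
      refine ⟨k, ?_⟩
      push_cast
      ring
    rw [h1, sub_self, zero_div, mul_zero]

/-- Cauchy's formula for the partition numbers. -/
lemma card_partition_eq_integral (n : ℕ) {y : ℝ} (hy : 0 < y) :
    ∫ x in (-1 / 2 : ℝ)..(1 / 2), Complex.exp (-(2 * π * Complex.I * n * (x + y * Complex.I))) *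
      (eulerProd (Complex.exp (2 * π * Complex.I * (x + y * Complex.I))))⁻¹ =
      (Fintype.card (Nat.Partition n) : ℂ) := by
  set r : ℝ := exp (-(2 * π * y)) with hr
  have hr1 : r < 1 := by
    rw [hr, exp_lt_one_iff]
    have : 0 < 2 * π * y := by have := pi_pos; positivity
    linarith
  have hnorm : ∀ x : ℝ, ‖Complex.exp (2 * π * Complex.I * (x + y * Complex.I))‖ = r := by
    intro x
    rw [norm_cexp_two_pi]
    simp [hr]
  have hsr := hasSum_card_partition (q := (r : ℂ)) (by
    rw [Complex.norm_real, Real.norm_of_nonneg (exp_pos _).le]; exact hr1)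
  have hsum : Summable fun m : ℕ => (Fintype.card (Nat.Partition m) : ℝ) * r ^ m := by
    have := hsr.summable
    exact_mod_cast this
  have hn0 : ∀ x : ℝ, ‖Complex.exp (-(2 * π * Complex.I * n * (x + y * Complex.I)))‖ =
      exp (2 * π * n * y) := by
    intro x
    rw [Complex.norm_exp]
    congr 1
    simp [mul_assoc]
  have hs := intervalIntegral.hasSum_integral_of_dominated_convergence
    (μ := MeasureTheory.volume) (a := (-1 / 2 : ℝ)) (b := 1 / 2)
    (F := fun (m : ℕ) (x : ℝ) => (Fintype.card (Nat.Partition m) : ℂ) *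
      Complex.exp (2 * π * Complex.I * ((m - n : ℤ) : ℂ) * (x + y * Complex.I)))
    (f := fun x : ℝ => Complex.exp (-(2 * π * Complex.I * n * (x + y * Complex.I))) *
      (eulerProd (Complex.exp (2 * π * Complex.I * (x + y * Complex.I))))⁻¹)
    (fun m _ => exp (2 * π * n * y) * ((Fintype.card (Nat.Partition m) : ℝ) * r ^ m))
    (fun m => Continuous.aestronglyMeasurable (by fun_prop))
    (fun m => Eventually.of_forall fun x _ => by
      have e : Complex.exp (2 * π * Complex.I * ((m - n : ℤ) : ℂ) * (x + y * Complex.I)) =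
          Complex.exp (-(2 * π * Complex.I * n * (x + y * Complex.I))) *
            Complex.exp (2 * π * Complex.I * (x + y * Complex.I)) ^ m := by
        rw [← Complex.exp_nat_mul, ← Complex.exp_add]
        congr 1
        push_cast
        ring
      rw [e, norm_mul, norm_mul, norm_pow, hnorm, hn0, Complex.norm_natCast]
      apply le_of_eq
      ring)
    (Eventually.of_forall fun x _ => hsum.mul_left _)
    (by simp)
    (Eventually.of_forall fun x _ => by
      have := (hasSum_card_partition (q := Complex.exp (2 * π * Complex.I * (x + y * Complex.I)))
        (by rw [hnorm]; exact hr1)).mul_left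
          (Complex.exp (-(2 * π * Complex.I * n * (x + y * Complex.I))))
      convert! this using 2 with m
      rw [mul_left_comm, ← Complex.exp_nat_mul, ← Complex.exp_add]
      congr 2
      push_cast
      ring)
  refine hs.unique ?_
  simp_rw [intervalIntegral.integral_const_mul, integral_cexp_two_pi]
  convert! hasSum_ite_eq n (Fintype.card (Nat.Partition n) : ℂ) using 2 with m
  by_cases h : m = n
  · simp [h]
  · have : (m : ℤ) - n ≠ 0 := by omega
    simp [h, this]

lemma exp_neg_pi_mul_le {Y : ℝ} (hY0 : 0 < Y) (hY : 3 ≤ 4 * Y ^ 2) : exp (-(2 * π * Y)) ≤ 0.0044 := by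
  have h1 : 0.866 ≤ Y := by nlinarith
  have h2 : 5.44 ≤ 2 * π * Y := by nlinarith [pi_gt_d6]
  have h3 : (1 / 0.0044 : ℝ) ≤ exp 5.44 := by
    have e1 : exp 5.44 = exp 1 ^ 5 * exp 0.44 := by
      rw [← exp_nat_mul, ← exp_add]; norm_num
    have e2 : (1.53 : ℝ) ≤ exp 0.44 := by
      have := quadratic_le_exp_of_nonneg (x := 0.44) (by norm_num)
      norm_num at this ⊢
      linarith
    have e3 : (2.718 : ℝ) ^ 5 ≤ exp 1 ^ 5 := by
      have := exp_one_gt_d9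
      gcongr
      linarith
    rw [e1]
    calc (1 / 0.0044 : ℝ) ≤ 2.718 ^ 5 * 1.54 := by norm_num
      _ ≤ exp 1 ^ 5 * exp 0.44 := by
        gcongr
        have := Real.sum_le_exp_of_nonneg (x := 0.44) (by norm_num) 4
        simp [Finset.sum_range_succ, Nat.factorial] at this
        norm_num at this ⊢
        linarith
  calc exp (-(2 * π * Y)) ≤ exp (-5.44) := by gcongr
    _ = (exp 5.44)⁻¹ := exp_neg _
    _ ≤ (1 / 0.0044)⁻¹ := by gcongr
    _ = 0.0044 := by norm_num

lemma norm_eulerProd_sub_one_le {q : ℂ} (hq : ‖q‖ < 1) : ‖eulerProd q - 1‖ ≤ ‖q‖ / (1 - ‖q‖) := by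
  have h := (hasSum_nat_add_iff' 1).mpr (hasSum_eulerProd hq)
  have h0 : (PowerSeries.pentagonalSeries ℤ).coeff 0 = 1 := by
    have := antidiagonal_pentagonal 0
    simpa using this
  simp only [Finset.sum_range_one, pow_zero, mul_one, h0, Int.cast_one] at h
  have hg : HasSum (fun n : ℕ => ‖q‖ ^ (n + 1)) (‖q‖ / (1 - ‖q‖)) := by
    have := (hasSum_geometric_of_lt_one (norm_nonneg q) hq).mul_left ‖q‖
    simpa [pow_succ', div_eq_mul_inv] using this
  rw [← h.tsum_eq]
  refine tsum_of_norm_bounded hg fun n => ?_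
  rw [norm_mul, norm_pow]
  have := norm_coeff_pentagonalSeries_le (n + 1)
  exact mul_le_of_le_one_left (by positivity) this

lemma norm_eulerProd_inv_sub_one_le {q : ℂ} (hq : ‖q‖ ≤ 0.0044) :
    ‖(eulerProd q)⁻¹ - 1‖ ≤ 1.01 * ‖q‖ := by
  have hq1 : ‖q‖ < 1 := by linarith
  have h1 := norm_eulerProd_sub_one_le hq1
  have h2 : ‖q‖ / (1 - ‖q‖) ≤ 1.0045 * ‖q‖ := by
    rw [div_le_iff₀ (by linarith)]
    nlinarith [norm_nonneg q]
  have h3 : 1 - 0.0045 ≤ ‖eulerProd q‖ := by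
    have := norm_sub_norm_le (1 : ℂ) (1 - eulerProd q)
    rw [sub_sub_cancel, norm_sub_rev 1, norm_one] at this
    linarith
  have hne := eulerProd_ne_zero hq1
  have : (eulerProd q)⁻¹ - 1 = -(eulerProd q - 1) / eulerProd q := by field_simp; ring
  rw [this, norm_div, norm_neg, div_le_iff₀ (by linarith)]
  nlinarith [norm_nonneg q]

lemma norm_eulerProd_inv_le {q : ℂ} (hq : ‖q‖ ≤ 0.0044) : ‖(eulerProd q)⁻¹‖ ≤ 1.005 := by
  have h := norm_eulerProd_inv_sub_one_le hq
  have := norm_add_le ((eulerProd q)⁻¹ - 1) 1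
  rw [sub_add_cancel, norm_one] at this
  linarith

lemma eta_eq (z : ℂ) : ModularForm.eta z =
    Complex.exp (2 * π * Complex.I * z / 24) * eulerProd (Complex.exp (2 * π * Complex.I * z)) := by
  simp [ModularForm.eta, eulerProd, Function.Periodic.qParam, ModularForm.eta_q_eq_pow]

lemma eta_inv_eq (z : ℂ) : (ModularForm.eta z)⁻¹ =
    Complex.exp (-(2 * π * Complex.I * z / 24)) *
      (eulerProd (Complex.exp (2 * π * Complex.I * z)))⁻¹ := by
  rw [eta_eq, mul_inv, Complex.exp_neg]

lemma norm_exp_neg_div (z : ℂ) :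
    ‖Complex.exp (-(2 * π * Complex.I * z / 24))‖ = exp (π / 12 * z.im) := by
  rw [Complex.norm_exp]
  congr 1
  have : -(2 * π * Complex.I * z / 24) = ((-(π / 12) : ℝ) : ℂ) * (Complex.I * z) := by
    push_cast; ring
  rw [this, Complex.re_ofReal_mul]
  simp

lemma norm_eta_inv_le {z : ℂ} (hz : 0 < z.im) (hz3 : 3 ≤ 4 * z.im ^ 2) :
    ‖(ModularForm.eta z)⁻¹‖ ≤ 1.005 * exp (π / 12 * z.im) := by
  rw [eta_inv_eq, norm_mul, norm_exp_neg_div, mul_comm]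
  gcongr
  apply norm_eulerProd_inv_le
  rw [norm_cexp_two_pi]
  exact exp_neg_pi_mul_le hz hz3

open UpperHalfPlane in
lemma norm_eta_smul (γ : Matrix.SpecialLinearGroup (Fin 2) ℤ) (z : UpperHalfPlane) :
    ‖ModularForm.eta (γ • z : UpperHalfPlane)‖ = √‖denom γ z‖ * ‖ModularForm.eta z‖ := by
  have h := congrFun (SlashInvariantForm.slash_action_generators_SL2Z
    ModularForm.discriminant_S_invariant ModularForm.discriminant_T_invariant γ) z
  have hd : denom γ z ≠ 0 := UpperHalfPlane.denom_ne_zero γ z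
  rw [ModularForm.SL_slash_apply] at h
  have h2 : ModularForm.eta (γ • z : UpperHalfPlane) ^ 24 = (denom γ z) ^ 12 * ModularForm.eta z ^ 24 := by
    rw [ModularForm.discriminant, ModularForm.discriminant] at h
    rw [← h, zpow_neg]
    rw [mul_comm, mul_assoc, show ((12 : ℤ)) = ((12 : ℕ) : ℤ) by rfl, zpow_natCast,
      inv_mul_cancel₀ (pow_ne_zero _ hd), mul_one]
  have h3 := congrArg norm h2
  rw [norm_pow, norm_mul, norm_pow, norm_pow] at h3
  have h4 : ‖ModularForm.eta (γ • z : UpperHalfPlane)‖ ^ 24 = (√‖denom γ z‖ * ‖ModularForm.eta z‖) ^ 24 := by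
    rw [h3, mul_pow, show (24 : ℕ) = 2 * 12 by rfl, pow_mul (√_), sq_sqrt (norm_nonneg _)]
  exact (pow_left_inj₀ (norm_nonneg _) (by positivity) (by norm_num)).mp h4

lemma exists_norm_eta_inv_le {z : ℂ} (hz : 0 < z.im) : ∃ c d : ℤ, IsCoprime c d ∧
    0 < Complex.normSq (c * z + d) ∧
    3 ≤ 4 * (z.im / Complex.normSq (c * z + d)) ^ 2 ∧ ‖(ModularForm.eta z)⁻¹‖ ≤
      1.005 * √‖c * z + d‖ * exp (π / 12 * (z.im / Complex.normSq (c * z + d))) := by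
  let τ : UpperHalfPlane := ⟨z, hz⟩
  obtain ⟨γ, hγ⟩ := ModularGroup.exists_smul_mem_fd τ
  have h3 := ModularGroup.three_le_four_mul_im_sq_of_mem_fd hγ
  have hden : UpperHalfPlane.denom γ τ = (γ 1 0 : ℂ) * z + γ 1 1 := by
    rw [ModularGroup.denom_apply]
  have him := ModularGroup.im_smul_eq_div_normSq γ τ
  rw [hden] at him
  have hτ : τ.im = z.im := rfl
  rw [hτ] at him
  have hn := norm_eta_smul γ τ
  rw [hden] at hn
  refine ⟨γ 1 0, γ 1 1, ?_, ?_, ?_, ?_⟩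
  · have := γ.det_coe
    rw [Matrix.det_fin_two] at this
    exact ⟨-γ 0 1, γ 0 0, by linarith⟩
  · rw [Complex.normSq_pos, ← hden]
    exact UpperHalfPlane.denom_ne_zero γ τ
  · rw [← him]; exact h3
  · have h4 := norm_eta_inv_le (z := (γ • τ : UpperHalfPlane)) (UpperHalfPlane.im_pos _) h3
    rw [UpperHalfPlane.coe_im, him, norm_inv, hn] at h4
    have hdpos : 0 < √‖(γ 1 0 : ℂ) * z + γ 1 1‖ := by
      rw [← hden]
      exact sqrt_pos.mpr (norm_pos_iff.mpr (UpperHalfPlane.denom_ne_zero γ τ))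
    rw [mul_inv] at h4
    rw [norm_inv]
    have h5 : ‖ModularForm.eta z‖⁻¹ = √‖(γ 1 0 : ℂ) * z + γ 1 1‖ *
        ((√‖(γ 1 0 : ℂ) * z + γ 1 1‖)⁻¹ * ‖ModularForm.eta z‖⁻¹) := by
      rw [← mul_assoc, mul_inv_cancel₀ hdpos.ne', one_mul]
    rw [h5]
    calc _ ≤ √‖(γ 1 0 : ℂ) * z + γ 1 1‖ *
        (1.005 * exp (π / 12 * (z.im / Complex.normSq ((γ 1 0 : ℂ) * z + γ 1 1)))) := by
          gcongr
      _ = _ := by ring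

lemma sqrt_I_mul {w : ℂ} (hw : 0 < w.re) :
    Complex.sqrt (Complex.I * w) = Complex.sqrt Complex.I * Complex.sqrt w := by
  have hw0 : w ≠ 0 := by rintro rfl; simp at hw
  rw [_root_.sqrt_eq_exp (mul_ne_zero Complex.I_ne_zero hw0), _root_.sqrt_eq_exp Complex.I_ne_zero,
    _root_.sqrt_eq_exp hw0, ← Complex.exp_add, Complex.log_mul Complex.I_ne_zero hw0]
  · congr 1; ring
  · have h := Complex.abs_arg_lt_pi_div_two_iff.mpr (Or.inl hw)
    rw [abs_lt] at h
    rw [Complex.arg_I]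
    constructor <;> linarith

lemma sqrt_sq' {w : ℂ} (hw : w ≠ 0) : Complex.sqrt w ^ 2 = w := by
  rw [_root_.sqrt_eq_exp hw, ← Complex.exp_nat_mul]
  push_cast
  rw [mul_div_cancel₀ _ two_ne_zero, Complex.exp_log hw]

lemma norm_csqrt {w : ℂ} (hw : w ≠ 0) : ‖Complex.sqrt w‖ = √‖w‖ := by
  rw [eq_comm, sqrt_eq_iff_mul_self_eq (norm_nonneg _) (norm_nonneg _), ← norm_mul, ← sq, sqrt_sq' hw]

lemma csqrt_ne_zero {w : ℂ} (hw : w ≠ 0) : Complex.sqrt w ≠ 0 := by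
  intro h
  have := sqrt_sq' hw
  rw [h] at this
  exact hw (by simpa using this.symm)

lemma eta_inv_I_mul {w : ℂ} (hw : 0 < w.re) : (ModularForm.eta (Complex.I * w))⁻¹ =
    Complex.sqrt w * (ModularForm.eta (Complex.I / w))⁻¹ := by
  have hw0 : w ≠ 0 := by rintro rfl; simp at hw
  have h := ModularForm.eta_comp_eq_csqrt_I_inv (x := Complex.I * w)
    (by simpa [UpperHalfPlane.upperHalfPlaneSet] using hw)
  simp only [Function.comp_apply, Pi.smul_apply, Pi.mul_apply, smul_eq_mul, sqrt_I_mul hw] at h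
  have e : -1 / (Complex.I * w) = Complex.I / w := by
    rw [div_eq_div_iff (mul_ne_zero Complex.I_ne_zero hw0) hw0]
    linear_combination (-w) * Complex.I_mul_I
  have hI := csqrt_ne_zero Complex.I_ne_zero
  have hs := csqrt_ne_zero hw0
  rw [e] at h
  rw [h]
  field_simp

lemma I_div_im {w : ℂ} : (Complex.I / w).im = w.re / Complex.normSq w := by
  rw [Complex.div_im]; simp

lemma norm_eta_inv_sub_of_im {w : ℂ} (hw : 0 < w.re) (h3 : 3 ≤ 4 * (w.re / Complex.normSq w) ^ 2) :
    ‖(ModularForm.eta (Complex.I * w))⁻¹ - Complex.sqrt w * Complex.exp (π / 12 / w)‖ ≤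
      1.01 * √‖w‖ := by
  have hw0 : w ≠ 0 := by rintro rfl; simp at hw
  have hY : 0 < (Complex.I / w).im := by
    rw [I_div_im]
    exact div_pos hw (Complex.normSq_pos.mpr hw0)
  have e : -(2 * π * Complex.I * (Complex.I / w) / 24) = π / 12 / w := by
    linear_combination (-(π : ℂ) / 12 / w) * Complex.I_mul_I
  rw [eta_inv_I_mul hw, ← mul_sub, eta_inv_eq, ← e, ← mul_sub_one, norm_mul, norm_mul, norm_csqrt hw0,
    norm_exp_neg_div, mul_comm 1.01]
  gcongr
  have hq : ‖Complex.exp (2 * π * Complex.I * (Complex.I / w))‖ ≤ 0.0044 := by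
    rw [norm_cexp_two_pi]
    exact exp_neg_pi_mul_le hY (by rw [I_div_im]; exact h3)
  calc _ ≤ exp (π / 12 * (Complex.I / w).im) * (1.01 * ‖Complex.exp (2 * π * Complex.I * (Complex.I / w))‖) := by
        gcongr
        exact norm_eulerProd_inv_sub_one_le hq
    _ = 1.01 * exp (π / 12 * (Complex.I / w).im + -(2 * π * (Complex.I / w).im)) := by
        rw [norm_cexp_two_pi, exp_add]; ring
    _ ≤ 1.01 := by
        have : exp (π / 12 * (Complex.I / w).im + -(2 * π * (Complex.I / w).im)) ≤ 1 := by
          rw [exp_le_one_iff]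
          nlinarith [mul_pos pi_pos hY]
        linarith

/-- The integrable majorant, in the variable `T = (x - 1/2) / y`, for the contribution of the cusps
`±1/2`. -/
noncomputable def cuspBound (y T : ℝ) : ℝ :=
  (√(1 + T ^ 2) ^ 3)⁻¹ * exp (-((π / (48 * y) - 2.7) * (T ^ 2 / (1 + T ^ 2))))

lemma cuspBound_nonneg (y T : ℝ) : 0 ≤ cuspBound y T := by
  unfold cuspBound; positivity

lemma one_le_exp_mul_one_sub {v : ℝ} (hv : 0 ≤ v) (hv1 : v ≤ 5 / 9) :
    1 ≤ exp (5.4 / 3.5 * v) * (1 - v) := by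
  have := Real.sum_le_exp_of_nonneg (x := 5.4 / 3.5 * v) (by positivity) 4
  simp only [Finset.sum_range_succ, Finset.sum_range_zero, Nat.factorial] at this
  push_cast at this
  have h2 : 1 ≤ (1 + 5.4 / 3.5 * v + (5.4 / 3.5 * v) ^ 2 / 2 + (5.4 / 3.5 * v) ^ 3 / 6) * (1 - v) := by
    nlinarith [mul_nonneg hv (sub_nonneg.mpr hv1),
      mul_nonneg (mul_nonneg hv hv) (sub_nonneg.mpr hv1),
      mul_nonneg (mul_nonneg (mul_nonneg hv hv) hv) (sub_nonneg.mpr hv1)]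
  refine h2.trans ?_
  gcongr
  · linarith
  · norm_num at this ⊢
    linarith

lemma sqrt_mul_exp_le_cuspBound {y T : ℝ} (hy : 0 < y) (hT : T ^ 2 ≤ 5 / 4) :
    √(2 * y * √(1 + T ^ 2)) * exp (π / (48 * y) * (1 / (1 + T ^ 2))) ≤
      √2 * √y * exp (π / (48 * y)) * cuspBound y T := by
  set A := π / (48 * y)
  set r := √(1 + T ^ 2) with hr
  have hr2 : r ^ 2 = 1 + T ^ 2 := sq_sqrt (by positivity)
  have hr0 : 0 < r := sqrt_pos.mpr (by positivity)
  set v := T ^ 2 / (1 + T ^ 2) with hv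
  have hv0 : 0 ≤ v := by positivity
  have hv1 : v ≤ 5 / 9 := by rw [hv, div_le_iff₀ (by positivity)]; linarith
  have e1 : 1 / (1 + T ^ 2) = 1 - v := by rw [hv]; field_simp; ring
  have key := one_le_exp_mul_one_sub hv0 hv1
  have k1 : r ^ 2 ≤ exp (5.4 / 3.5 * v) := by
    rw [← e1, hr2.symm, mul_one_div, le_div_iff₀ (by positivity), one_mul] at key
    exact key
  have k2 : √r * r ^ 3 ≤ exp (2.7 * v) := by
    have : (√r * r ^ 3) ^ 4 ≤ exp (2.7 * v) ^ 4 := by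
      calc (√r * r ^ 3) ^ 4 = (r ^ 2) ^ 7 := by
            rw [mul_pow, show √r ^ 4 = (√r ^ 2) ^ 2 by ring, sq_sqrt hr0.le]; ring
        _ ≤ exp (5.4 / 3.5 * v) ^ 7 := by gcongr
        _ = exp (2.7 * v) ^ 4 := by
            rw [← exp_nat_mul, ← exp_nat_mul]; congr 1; push_cast; ring
    exact le_of_pow_le_pow_left₀ (by norm_num) (exp_pos _).le this
  have e2 : exp (-((A - 2.7) * v)) = exp (2.7 * v) * exp (-(A * v)) := by
    rw [← exp_add]; congr 1; ring
  rw [cuspBound, ← hr, ← hv, e1, e2, sqrt_mul (by positivity), sqrt_mul (by norm_num), mul_sub, mul_one,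
    sub_eq_add_neg, exp_add]
  have : √r ≤ (r ^ 3)⁻¹ * exp (2.7 * v) := by
    rw [inv_mul_eq_div, le_div_iff₀ (by positivity)]
    exact k2
  calc √2 * √y * √r * (exp A * exp (-(A * v))) ≤
      √2 * √y * ((r ^ 3)⁻¹ * exp (2.7 * v)) * (exp A * exp (-(A * v))) := by gcongr
    _ = _ := by ring

lemma norm_csqrt_mul_exp_le {x y : ℝ} (hy : 0 < y) (hy1 : y ≤ 1 / 200) (hx : |x| ≤ 1 / 2)
    (h : y / (x ^ 2 + y ^ 2) ≤ 1.16) :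
    ‖Complex.sqrt (y - x * Complex.I) * Complex.exp (π / 12 / (y - x * Complex.I))‖ ≤ 2 := by
  have hw0 : (y - x * Complex.I : ℂ) ≠ 0 := by
    intro h
    have := congrArg Complex.re h
    simp at this
    linarith
  have hn : Complex.normSq (y - x * Complex.I) = x ^ 2 + y ^ 2 := by
    rw [Complex.normSq_apply]; simp; ring
  have e : (π / 12 / (y - x * Complex.I) : ℂ) = ((π / 12 : ℝ) : ℂ) * (y - x * Complex.I)⁻¹ := by
    push_cast; ring
  have hre : ((y - x * Complex.I : ℂ)⁻¹).re = y / (x ^ 2 + y ^ 2) := by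
    rw [Complex.inv_re, hn]; simp
  rw [norm_mul, norm_csqrt hw0, Complex.norm_exp, e, Complex.re_ofReal_mul, hre]
  have h1 : √‖(y - x * Complex.I : ℂ)‖ ≤ 1 := by
    refine sqrt_le_one.mpr (sqrt_le_one.mpr ?_)
    rw [hn]
    have := abs_le.mp hx
    nlinarith
  have h2 : exp (π / 12 * (y / (x ^ 2 + y ^ 2))) ≤ 2 := by
    rw [← Real.le_log_iff_exp_le (by norm_num)]
    have : 0 ≤ y / (x ^ 2 + y ^ 2) := by positivity
    nlinarith [log_two_gt_d9, pi_lt_d2, pi_pos]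
  nlinarith [sqrt_nonneg ‖(y - x * Complex.I : ℂ)‖, exp_pos (π / 12 * (y / (x ^ 2 + y ^ 2)))]

lemma eq_of_near_cusp {x y Q : ℝ} (hy : 0 < y) (hx : |x| ≤ 1 / 2) {c d : ℤ} (hd : d ≠ 0)
    (habs : |c * x + d| ≤ 0.08) (hQdef : Q = (c * x + d) ^ 2 + c ^ 2 * y ^ 2)
    (hfar : Q < 9 * y ^ 2) : Q = 4 * y ^ 2 * (1 + ((x - 1 / 2) / y) ^ 2) ∨
      Q = 4 * y ^ 2 * (1 + ((x + 1 / 2) / y) ^ 2) := by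
  have hxx := abs_le.mp hx
  replace habs := abs_le.mp habs
  have hc2 : (c : ℝ) ^ 2 < 9 := by
    have : (c : ℝ) ^ 2 * y ^ 2 < 9 * y ^ 2 := by nlinarith [sq_nonneg (c * x + d : ℝ)]
    exact lt_of_mul_lt_mul_right this (by positivity)
  have hc3 : c ^ 2 < 9 := by exact_mod_cast hc2
  have hcr : -3 < c ∧ c < 3 := ⟨by nlinarith, by nlinarith⟩
  have hd3 : -2 < d ∧ d < 2 := by
    have hcx : |(c * x : ℝ)| ≤ 1 := by
      rw [abs_mul]
      have : |(c : ℝ)| ≤ 2 := by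
        exact_mod_cast abs_le.mpr ⟨by linarith [hcr.1], by linarith [hcr.2]⟩
      nlinarith [abs_nonneg x, abs_nonneg (c : ℝ)]
    have := abs_le.mp hcx
    constructor
    · have : (-2 : ℝ) < d := by linarith
      exact_mod_cast this
    · have : (d : ℝ) < 2 := by linarith
      exact_mod_cast this
  have hlow : (0.42 : ℝ) ≤ |(c : ℝ) * x| := by
    have h1 : (1 : ℝ) ≤ |(d : ℝ)| := by exact_mod_cast Int.one_le_abs hd
    have h2 : |(c * x + d : ℝ)| ≤ 0.08 := abs_le.mpr habs
    have h3 := abs_sub_abs_le_abs_sub (d : ℝ) (-(c * x))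
    rw [abs_neg, sub_neg_eq_add, add_comm (d : ℝ)] at h3
    linarith
  obtain ⟨hcl, hcu⟩ := hcr
  obtain ⟨hdl, hdu⟩ := hd3
  have hcase : (c = 2 ∨ c = -2) ∧ (d = 1 ∨ d = -1) := by
    refine ⟨?_, by omega⟩
    have : c ≠ 0 := by
      rintro rfl
      norm_num at hlow
    have hd' : d = 1 ∨ d = -1 := by omega
    have h1 : c ≠ 1 := by
      rintro rfl
      rcases hd' with rfl | rfl <;> push_cast at habs <;> linarith [habs.1, habs.2, hxx.1, hxx.2]
    have h2 : c ≠ -1 := by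
      rintro rfl
      rcases hd' with rfl | rfl <;> push_cast at habs <;> linarith [habs.1, habs.2, hxx.1, hxx.2]
    omega
  rcases hcase with ⟨rfl | rfl, rfl | rfl⟩
  · right; rw [hQdef]; push_cast; field_simp; ring
  · left; rw [hQdef]; push_cast; field_simp; ring
  · left; rw [hQdef]; push_cast; field_simp; ring
  · right; rw [hQdef]; push_cast; field_simp; ring

lemma norm_le_cuspBound {y T Q : ℝ} (hy : 0 < y) (hfar : Q < 9 * y ^ 2)
    (hT : Q = 4 * y ^ 2 * (1 + T ^ 2)) : 1.005 * √√Q * exp (π / 12 * (y / Q)) ≤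
      1.005 * (√2 * √y * exp (π / (48 * y))) * cuspBound y T := by
  have hT2 : T ^ 2 ≤ 5 / 4 := by
    rw [hT] at hfar
    have : y ^ 2 * (1 + T ^ 2) ≤ y ^ 2 * (9 / 4) := by linarith
    have := le_of_mul_le_mul_left this (by positivity)
    linarith
  have h := sqrt_mul_exp_le_cuspBound hy hT2
  have e1 : √Q = 2 * y * √(1 + T ^ 2) := by
    rw [hT, sqrt_mul (by positivity), show 4 * y ^ 2 = (2 * y) ^ 2 by ring,
      sqrt_sq (by positivity)]
  have e2 : π / 12 * (y / Q) = π / (48 * y) * (1 / (1 + T ^ 2)) := by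
    rw [hT]; field_simp; norm_num
  rw [e1, e2, mul_assoc, mul_assoc 1.005]
  exact mul_le_mul_of_nonneg_left h (by norm_num)

lemma norm_le_of_far {y Q : ℝ} (hy : 0 < y) (hpos : 0 < Q) (hfar : 9 * y ^ 2 ≤ Q)
    (hQy : Q ≤ 1.16 * y) : 1.005 * √√Q * exp (π / 12 * (y / Q)) ≤
      1.005 * √√(1.16 * y) * exp (π / (108 * y)) := by
  have h1 : y / Q ≤ 1 / (9 * y) := by
    rw [div_le_div_iff₀ hpos (by positivity)]
    nlinarith
  have h2 : π / 12 * (y / Q) ≤ π / (108 * y) := by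
    calc π / 12 * (y / Q) ≤ π / 12 * (1 / (9 * y)) := by gcongr
      _ = π / (108 * y) := by field_simp; norm_num
  gcongr

lemma norm_eta_inv_sub_le {x y : ℝ} (hy : 0 < y) (hy1 : y ≤ 1 / 200) (hx : |x| ≤ 1 / 2) :
    ‖(ModularForm.eta (x + y * Complex.I))⁻¹ -
      Complex.sqrt (y - x * Complex.I) * Complex.exp (π / 12 / (y - x * Complex.I))‖ ≤
      2 + 1.005 * √√(1.16 * y) * exp (π / (108 * y)) +
        1.005 * (√2 * √y * exp (π / (48 * y))) *
          (cuspBound y ((x - 1 / 2) / y) + cuspBound y ((x + 1 / 2) / y)) := by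
  set w : ℂ := y - x * Complex.I with hw
  have hwre : w.re = y := by simp [hw]
  have hIw : (x + y * Complex.I : ℂ) = Complex.I * w := by
    rw [hw]; linear_combination (x : ℂ) * Complex.I_mul_I
  have hnw : Complex.normSq w = x ^ 2 + y ^ 2 := by
    rw [hw, Complex.normSq_apply]; simp; ring
  have hxx := abs_le.mp hx
  have hp1 : 0 ≤ 1.005 * √√(1.16 * y) * exp (π / (108 * y)) := by positivity
  have hp2 : 0 ≤ 1.005 * (√2 * √y * exp (π / (48 * y))) * cuspBound y ((x - 1 / 2) / y) :=
    mul_nonneg (by positivity) (cuspBound_nonneg _ _)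
  have hp3 : 0 ≤ 1.005 * (√2 * √y * exp (π / (48 * y))) * cuspBound y ((x + 1 / 2) / y) :=
    mul_nonneg (by positivity) (cuspBound_nonneg _ _)
  have him : (x + y * Complex.I : ℂ).im = y := by simp
  obtain ⟨c, d, hcd, hpos, h3, hb⟩ := exists_norm_eta_inv_le (z := x + y * Complex.I) (by rw [him]; exact hy)
  rw [him] at h3 hb
  have hQ : Complex.normSq (c * (x + y * Complex.I) + d) = (c * x + d) ^ 2 + c ^ 2 * y ^ 2 := by
    rw [Complex.normSq_apply]; simp; ring
  rw [Complex.norm_def (c * (x + y * Complex.I) + d), hQ] at hb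
  rw [hQ] at h3 hpos
  set Q : ℝ := (c * x + d) ^ 2 + c ^ 2 * y ^ 2 with hQdef
  have hY : 0.866 ≤ y / Q := by
    have : 0 < y / Q := by positivity
    nlinarith
  have hQy : Q ≤ 1.16 * y := by
    rw [le_div_iff₀ hpos] at hY; linarith
  have hsmall : (c * x + d) ^ 2 ≤ 0.08 ^ 2 := by
    have : (0 : ℝ) ≤ c ^ 2 * y ^ 2 := by positivity
    nlinarith
  have habs := abs_le_of_sq_le_sq' hsmall (by norm_num)
  -- the case of the cusp `0`
  by_cases hd : d = 0
  · have hc : (c : ℝ) ^ 2 = 1 := by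
      rw [hd, isCoprime_zero_right, Int.isUnit_iff] at hcd
      rcases hcd with rfl | rfl <;> norm_num
    have hQ' : Q = Complex.normSq w := by
      rw [hQdef, hnw, hd]
      push_cast
      linear_combination (x ^ 2 + y ^ 2) * hc
    have := norm_eta_inv_sub_of_im (w := w) (by rw [hwre]; exact hy) (by rw [hwre, ← hQ']; exact h3)
    rw [hIw]
    have h1 : √‖w‖ ≤ 1 := by
      refine sqrt_le_one.mpr (sqrt_le_one.mpr ?_)
      rw [hnw]
      nlinarith
    linarith
  · have hd1 : (1 : ℝ) ≤ d ^ 2 := by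
      exact_mod_cast Int.one_le_abs hd |>.trans (by nlinarith [sq_abs d, Int.one_le_abs hd])
    have hmain : ‖Complex.sqrt w * Complex.exp (π / 12 / w)‖ ≤ 2 := by
      apply norm_csqrt_mul_exp_le hy hy1 hx
      have hxy : 0 < x ^ 2 + y ^ 2 := by positivity
      have h1 : y ^ 2 ≤ Q * (x ^ 2 + y ^ 2) := by
        have : Q * (x ^ 2 + y ^ 2) = ((c * x + d) * x + c * y ^ 2) ^ 2 + d ^ 2 * y ^ 2 := by
          rw [hQdef]; ring
        rw [this]
        nlinarith [sq_nonneg ((c * x + d) * x + c * y ^ 2), sq_nonneg y]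
      rw [div_le_iff₀ hxy]
      have h2 : y * y ≤ y * (1.16 * (x ^ 2 + y ^ 2)) := by nlinarith
      exact le_of_mul_le_mul_left h2 hy
    have htri := norm_sub_le (ModularForm.eta (x + y * Complex.I))⁻¹ (Complex.sqrt w * Complex.exp (π / 12 / w))
    by_cases hfar : 9 * y ^ 2 ≤ Q
    · rw [mul_add]
      linarith only [htri, hmain, hb, norm_le_of_far hy hpos hfar hQy, hp2, hp3]
    · push Not at hfar
      have hT := eq_of_near_cusp hy hx hd (abs_le.mpr habs) hQdef hfar
      rw [mul_add]
      rcases hT with hT | hT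
      · linarith only [htri, hmain, hb, norm_le_cuspBound hy hfar hT, hp1, hp3]
      · linarith only [htri, hmain, hb, norm_le_cuspBound hy hfar hT, hp1, hp2]

lemma continuous_cuspBound (y : ℝ) : Continuous (cuspBound y) := by
  unfold cuspBound
  have h : ∀ T : ℝ, 0 < 1 + T ^ 2 := fun T => by positivity
  refine Continuous.mul (Continuous.inv₀ (by fun_prop) fun T => ?_) ?_
  · have := sqrt_pos.mpr (h T)
    positivity
  · refine Real.continuous_exp.comp (Continuous.neg (Continuous.mul continuous_const ?_))
    exact Continuous.div (by fun_prop) (by fun_prop) fun T => (h T).ne'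

lemma hasDerivAt_div_sqrt (T : ℝ) :
    HasDerivAt (fun T : ℝ => T / √(1 + T ^ 2)) (√(1 + T ^ 2) ^ 3)⁻¹ T := by
  have h : 0 < 1 + T ^ 2 := by positivity
  have hs := sqrt_pos.mpr h
  have h1 : HasDerivAt (fun T : ℝ => 1 + T ^ 2) (2 * T) T := by
    simpa using (hasDerivAt_pow 2 T).const_add 1
  refine ((hasDerivAt_id' T).div (h1.sqrt h.ne') hs.ne').congr_deriv ?_
  have := sq_sqrt h.le
  field_simp
  rw [this]
  ring

lemma integral_cuspBound_le {y : ℝ} (L : ℝ) (hL : 0 ≤ L) (hA : 2.7 < π / (48 * y)) :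
    ∫ T in -L..L, cuspBound y T ≤ √(π / (π / (48 * y) - 2.7)) := by
  set B := π / (48 * y) - 2.7 with hB
  have hB0 : 0 < B := by linarith
  have h1 : ∫ T in -L..L, cuspBound y T =
      ∫ T in -L..L, ((fun u => exp (-B * u ^ 2)) ∘ fun T => T / √(1 + T ^ 2)) T * (√(1 + T ^ 2) ^ 3)⁻¹ := by
    congr 1
    ext T
    simp only [cuspBound, Function.comp_apply]
    rw [mul_comm, div_pow, sq_sqrt (by positivity), neg_mul]
  rw [h1, intervalIntegral.integral_comp_mul_deriv (fun T _ => hasDerivAt_div_sqrt T) ?_ (by fun_prop),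
    intervalIntegral.integral_of_le, ← integral_gaussian]
  · exact MeasureTheory.setIntegral_le_integral (integrable_exp_neg_mul_sq hB0)
      (Eventually.of_forall fun _ => (exp_pos _).le)
  · have : 0 ≤ L / √(1 + L ^ 2) := by positivity
    rw [neg_sq, neg_div]
    linarith
  · refine Continuous.continuousOn (Continuous.inv₀ (by fun_prop) fun T => ?_)
    have : 0 < √(1 + T ^ 2) := sqrt_pos.mpr (by positivity)
    positivity

lemma integral_cuspBound_add_le {y : ℝ} (hy : 0 < y) (hA : 2.7 < π / (48 * y)) :
    ∫ x in (-1 / 2 : ℝ)..(1 / 2), (cuspBound y ((x - 1 / 2) / y) + cuspBound y ((x + 1 / 2) / y)) ≤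
      y * √(π / (π / (48 * y) - 2.7)) := by
  have hc := continuous_cuspBound y
  have e1 : ∫ x in (-1 / 2 : ℝ)..(1 / 2), cuspBound y ((x - 1 / 2) / y) =
      y * ∫ T in -(1 / y)..0, cuspBound y T := by
    have := intervalIntegral.integral_comp_div_sub (a := -1 / 2) (b := 1 / 2) (cuspBound y) hy.ne' (1 / (2 * y))
    convert this using 2
    · ext x; congr 1; field_simp
    · rw [smul_eq_mul]; congr 2 <;> (field_simp; try ring)
  have e2 : ∫ x in (-1 / 2 : ℝ)..(1 / 2), cuspBound y ((x + 1 / 2) / y) =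
      y * ∫ T in 0..(1 / y), cuspBound y T := by
    have := intervalIntegral.integral_comp_div_add (a := -1 / 2) (b := 1 / 2) (cuspBound y) hy.ne' (1 / (2 * y))
    convert this using 2
    · ext x; congr 1; field_simp
    · rw [smul_eq_mul]; congr 2 <;> (field_simp; try ring)
  rw [intervalIntegral.integral_add, e1, e2, ← mul_add,
    intervalIntegral.integral_add_adjacent_intervals (hc.intervalIntegrable _ _) (hc.intervalIntegrable _ _)]
  · gcongr
    exact integral_cuspBound_le _ (by positivity) hA
  · exact (hc.comp (by fun_prop)).intervalIntegrable _ _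
  · exact (hc.comp (by fun_prop)).intervalIntegrable _ _

lemma gaussian_intervalIntegrable (a b : ℝ) :
    IntervalIntegrable (fun t : ℝ => exp (-t ^ 2)) MeasureTheory.volume a b :=
  (by fun_prop : Continuous fun t : ℝ => exp (-t ^ 2)).intervalIntegrable _ _

lemma tendsto_integral_gaussian :
    Tendsto (fun L : ℝ => ∫ t in 0..L, exp (-t ^ 2)) atTop (𝓝 (√π / 2)) := by
  have h1 := integrable_exp_neg_mul_sq (b := 1) one_pos
  have h2 := integral_gaussian_Ioi 1
  simp only [neg_mul, one_mul, div_one] at h1 h2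
  rw [← h2]
  exact MeasureTheory.intervalIntegral_tendsto_integral_Ioi 0 h1.integrableOn tendsto_id

lemma monotone_integral_gaussian : Monotone (fun L : ℝ => ∫ t in 0..L, exp (-t ^ 2)) := by
  intro a b hab
  have := intervalIntegral.integral_add_adjacent_intervals (gaussian_intervalIntegrable 0 a) (gaussian_intervalIntegrable a b)
  have h2 : 0 ≤ ∫ t in a..b, exp (-t ^ 2) :=
    intervalIntegral.integral_nonneg hab fun _ _ => (exp_pos _).le
  simp only
  linarith

lemma integral_gaussian_le (L : ℝ) : ∫ t in 0..L, exp (-t ^ 2) ≤ √π / 2 :=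
  monotone_integral_gaussian.ge_of_tendsto tendsto_integral_gaussian L

lemma abs_integral_gaussian_sub_le {β : ℝ} (hβ : 0 ≤ β) :
    |(∫ t in 0..β, exp (-t ^ 2)) - √π / 2| ≤ √π / 2 * exp (-β ^ 2) := by
  rw [abs_sub_comm, abs_of_nonneg (sub_nonneg.mpr (integral_gaussian_le β))]
  refine le_of_tendsto (tendsto_integral_gaussian.sub_const _) ?_
  filter_upwards [eventually_ge_atTop β] with L hL
  rw [intervalIntegral.integral_interval_sub_left (gaussian_intervalIntegrable _ _) (gaussian_intervalIntegrable _ _)]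
  have e : ∫ t in β..L, exp (-t ^ 2) = ∫ t in 0..(L - β), exp (-(t + β) ^ 2) := by
    rw [intervalIntegral.integral_comp_add_right (fun t => exp (-t ^ 2))]
    simp
  rw [e]
  calc ∫ t in 0..(L - β), exp (-(t + β) ^ 2) ≤ ∫ t in 0..(L - β), exp (-t ^ 2) * exp (-β ^ 2) := by
        refine intervalIntegral.integral_mono_on (by linarith)
          ((by fun_prop : Continuous fun t : ℝ => exp (-(t + β) ^ 2)).intervalIntegrable _ _)
          ((by fun_prop : Continuous fun t : ℝ => exp (-t ^ 2) * exp (-β ^ 2)).intervalIntegrable _ _)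
          fun t ht => ?_
        rw [← exp_add, exp_le_exp]
        nlinarith [mul_nonneg ht.1 hβ]
    _ = (∫ t in 0..(L - β), exp (-t ^ 2)) * exp (-β ^ 2) := by
        rw [intervalIntegral.integral_mul_const]
    _ ≤ √π / 2 * exp (-β ^ 2) := by
        gcongr
        exact integral_gaussian_le _

lemma exists_primitive_exp_sq : ∃ G : ℂ → ℂ, (∀ v, HasDerivAt G (Complex.exp (v ^ 2)) v) ∧
    ∀ (v : ℂ) (σ : ℝ), (σ = 1 ∨ σ = -1) → 0 ≤ σ * v.im →
      ‖G v - σ * (√π / 2 * Complex.I)‖ ≤ (|v.re| + √π / 2) * exp (v.re ^ 2 - v.im ^ 2) := by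
  have hd : Differentiable ℂ fun v : ℂ => Complex.exp (v ^ 2) := by fun_prop
  obtain ⟨G, hG0, hG⟩ := hd.isExactOn_univ.with_val_at 0 0
  replace hG : ∀ v, HasDerivAt G (Complex.exp (v ^ 2)) v := fun v => hG v (Set.mem_univ _)
  refine ⟨G, hG, fun v σ hσ hv => ?_⟩
  have hσ2 : σ * σ = 1 := by rcases hσ with rfl | rfl <;> norm_num
  have hσ2' : (σ : ℂ) * σ = 1 := by exact_mod_cast hσ2
  set β := σ * v.im with hβ
  have hvim : v.im = σ * β := by rw [hβ, ← mul_assoc, hσ2, one_mul]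
  have h1 : G (σ * β * Complex.I) = σ * Complex.I * ((∫ t in 0..β, exp (-t ^ 2) : ℝ) : ℂ) := by
    have hder : ∀ t ∈ Set.uIcc 0 β, HasDerivAt (fun t : ℝ => G (σ * t * Complex.I))
        (σ * Complex.I * ((exp (-t ^ 2) : ℝ) : ℂ)) t := by
      intro t _
      have hl : HasDerivAt (fun t : ℝ => (σ * t * Complex.I : ℂ)) (σ * Complex.I) t := by
        have := ((hasDerivAt_id (t : ℂ)).const_mul (σ : ℂ)).mul_const Complex.I |>.comp_ofReal
        simpa using this
      have := HasDerivAt.scomp t (hG (σ * t * Complex.I)) hl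
      refine this.congr_deriv ?_
      rw [smul_eq_mul]
      congr 1
      push_cast
      congr 1
      linear_combination (t : ℂ) ^ 2 * Complex.I ^ 2 * hσ2' + (t : ℂ) ^ 2 * Complex.I_mul_I
    have := intervalIntegral.integral_eq_sub_of_hasDerivAt hder
      ((by fun_prop : Continuous fun t : ℝ => (σ * Complex.I * ((exp (-t ^ 2) : ℝ) : ℂ))).intervalIntegrable _ _)
    rw [intervalIntegral.integral_const_mul, intervalIntegral.integral_ofReal] at this
    rw [this]
    simp [hG0]
  have h2 : ‖G v - G (σ * β * Complex.I)‖ ≤ |v.re| * exp (v.re ^ 2 - v.im ^ 2) := by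
    have hder : ∀ t ∈ Set.uIcc 0 v.re, HasDerivAt (fun t : ℝ => G (t + σ * β * Complex.I))
        (Complex.exp ((t + σ * β * Complex.I) ^ 2)) t := by
      intro t _
      have hl : HasDerivAt (fun t : ℝ => (t + σ * β * Complex.I : ℂ)) 1 t := by
        have := ((hasDerivAt_id (t : ℂ)).add_const (σ * β * Complex.I : ℂ)).comp_ofReal
        simpa using this
      have := HasDerivAt.scomp t (hG (t + σ * β * Complex.I)) hl
      refine this.congr_deriv ?_
      rw [one_smul]
    have h := intervalIntegral.integral_eq_sub_of_hasDerivAt hder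
      ((by fun_prop : Continuous fun t : ℝ => Complex.exp ((t + σ * β * Complex.I : ℂ) ^ 2)).intervalIntegrable _ _)
    have e : (v.re : ℂ) + σ * β * Complex.I = v := by
      conv_rhs => rw [← Complex.re_add_im v, hvim]
      push_cast; ring
    rw [e, Complex.ofReal_zero, zero_add] at h
    rw [← h]
    refine (intervalIntegral.norm_integral_le_of_norm_le_const (C := exp (v.re ^ 2 - v.im ^ 2)) ?_).trans_eq
      (by rw [sub_zero, mul_comm])
    · intro t ht
      rw [Complex.norm_exp, exp_le_exp]
      have : ((t + σ * β * Complex.I : ℂ) ^ 2).re = t ^ 2 - v.im ^ 2 := by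
        rw [hvim, sq, Complex.mul_re]
        simp
        ring
      rw [this]
      have : |t| ≤ |v.re| := by
        rcases Set.mem_uIoc.mp ht with h | h
        · rw [abs_of_pos h.1, abs_of_pos (h.1.trans_le h.2)]; exact h.2
        · rw [abs_of_nonpos h.2, abs_of_neg (h.1.trans_le h.2)]; linarith [h.1]
      have := sq_le_sq.mpr this
      linarith
  have h3 : ‖G (σ * β * Complex.I) - σ * (√π / 2 * Complex.I)‖ ≤ √π / 2 * exp (v.re ^ 2 - v.im ^ 2) := by
    rw [h1]
    have e : σ * Complex.I * ((∫ t in 0..β, exp (-t ^ 2) : ℝ) : ℂ) - σ * (√π / 2 * Complex.I) =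
        σ * Complex.I * (((∫ t in 0..β, exp (-t ^ 2)) - √π / 2 : ℝ) : ℂ) := by
      push_cast; ring
    have hn : |σ| = 1 := by rcases hσ with rfl | rfl <;> norm_num
    rw [e, norm_mul, norm_mul, Complex.norm_I, Complex.norm_real, Complex.norm_real, Real.norm_eq_abs,
      Real.norm_eq_abs, hn, one_mul, one_mul]
    refine (abs_integral_gaussian_sub_le hv).trans ?_
    have : v.im ^ 2 = β ^ 2 := by rw [hvim]; linear_combination β ^ 2 * hσ2
    rw [this]
    gcongr
    nlinarith [sq_nonneg v.re]
  calc _ = ‖(G v - G (σ * β * Complex.I)) + (G (σ * β * Complex.I) - σ * (√π / 2 * Complex.I))‖ := by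
        congr 1; ring
    _ ≤ _ := norm_add_le _ _
    _ ≤ _ := by linarith

lemma hasDerivAt_csqrt_line {y : ℝ} (hy : 0 < y) (x : ℝ) :
    HasDerivAt (fun x : ℝ => Complex.sqrt (y - x * Complex.I))
      (-Complex.I / (2 * Complex.sqrt (y - x * Complex.I))) x := by
  have hre : ((y : ℂ) - x * Complex.I).re = y := by simp
  have hsl : ((y : ℂ) - x * Complex.I) ∈ Complex.slitPlane := by
    left; rw [hre]; exact hy
  have hw : ((y : ℂ) - x * Complex.I) ≠ 0 := Complex.slitPlane_ne_zero hsl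
  have hl : HasDerivAt (fun x : ℝ => (y - x * Complex.I : ℂ)) (-Complex.I) x := by
    have := (((hasDerivAt_id (x : ℂ)).mul_const Complex.I).const_sub (y : ℂ)).comp_ofReal
    simpa using this
  have h1 := ((hl.clog_real hsl).div_const 2).cexp
  have e : (fun x : ℝ => Complex.sqrt (y - x * Complex.I)) =ᶠ[𝓝 x]
      fun x : ℝ => Complex.exp (Complex.log (y - x * Complex.I) / 2) := by
    refine Eventually.of_forall fun t => ?_
    have : ((y : ℂ) - t * Complex.I) ≠ 0 := fun h => by
      have := congrArg Complex.re h
      simp at this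
      exact hy.ne' this
    exact _root_.sqrt_eq_exp this
  refine (h1.congr_of_eventuallyEq e).congr_deriv ?_
  rw [← _root_.sqrt_eq_exp hw]
  have hz := csqrt_ne_zero hw
  have hz2 := sqrt_sq' hw
  set z := Complex.sqrt (y - x * Complex.I)
  rw [← hz2]
  field_simp

/-- A primitive of `2 z² exp (p² z² + q² / z²)` and its size near the two branches of infinity. -/
lemma exists_primitive_sq_mul_exp {p q : ℝ} (hp : 0 < p) (hq : 0 < q) (hpq : 1 ≤ 2 * p * q) :
    ∃ Φ : ℂ → ℂ,
      (∀ z, z ≠ 0 → HasDerivAt Φ (2 * z ^ 2 * Complex.exp (p ^ 2 * z ^ 2 + q ^ 2 / z ^ 2)) z) ∧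
      ∀ (z : ℂ) (σ : ℝ), z ≠ 0 → (σ = 1 ∨ σ = -1) → 0 ≤ σ * z.im → q ≤ p * ‖z‖ ^ 2 →
        ‖Φ z - σ * ((√π / (4 * p ^ 3) * ((2 * p * q - 1) * exp (2 * p * q) -
            (2 * p * q + 1) * exp (-(2 * p * q))) : ℝ) * Complex.I)‖ ≤
          1 / p ^ 2 * (‖z‖ + 2 * q * (p * ‖z‖ + q / ‖z‖ + √π / 2)) *
            exp ((p ^ 2 * z ^ 2 + q ^ 2 / z ^ 2 : ℂ).re) := by
  obtain ⟨G, hG, hGb⟩ := exists_primitive_exp_sq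
  have hpc : (p : ℂ) ≠ 0 := by exact_mod_cast hp.ne'
  set μ := 2 * p * q with hμ
  refine ⟨fun z => 1 / p ^ 2 * (z * Complex.exp (p ^ 2 * z ^ 2 + q ^ 2 / z ^ 2) + 1 / (2 * p) *
    ((μ - 1) * Complex.exp μ * G (p * z - q / z) - (μ + 1) * Complex.exp (-μ) * G (p * z + q / z))),
    fun z hz => ?_, fun z σ hz hσ hσz hqz => ?_⟩
  · have d1 : HasDerivAt (fun z : ℂ => (p : ℂ) * z) p z := by
      simpa using (hasDerivAt_id z).const_mul (p : ℂ)
    have d2 : HasDerivAt (fun z : ℂ => (q : ℂ) / z) (-(q / z ^ 2)) z := by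
      refine ((hasDerivAt_inv hz).const_mul (q : ℂ)).congr_deriv ?_
      field_simp
    have d3 : HasDerivAt (fun z : ℂ => (p : ℂ) ^ 2 * z ^ 2 + q ^ 2 / z ^ 2)
        (2 * p ^ 2 * z - 2 * q ^ 2 / z ^ 3) z := by
      have := ((d1.pow 2).add (d2.pow 2))
      refine (this.congr_of_eventuallyEq (Eventually.of_forall fun t => ?_)).congr_deriv ?_
      · simp only [Pi.add_apply, Pi.pow_apply]; ring
      · push_cast
        field_simp
        ring
    have g1 := HasDerivAt.comp z (hG (p * z - q / z)) (d1.sub d2)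
    have g2 := HasDerivAt.comp z (hG (p * z + q / z)) (d1.add d2)
    have := (((hasDerivAt_id z).mul d3.cexp).add (((g1.const_mul ((μ - 1) * Complex.exp μ)).sub
      (g2.const_mul ((μ + 1) * Complex.exp (-μ)))).const_mul (1 / (2 * p) : ℂ))).const_mul
        (1 / p ^ 2 : ℂ)
    refine this.congr_deriv ?_
    have e1 : Complex.exp ((p * z - q / z) ^ 2) =
        Complex.exp (p ^ 2 * z ^ 2 + q ^ 2 / z ^ 2) * Complex.exp (-μ) := by
      rw [← Complex.exp_add]; congr 1; rw [hμ]; push_cast; field_simp; ring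
    have e2 : Complex.exp ((p * z + q / z) ^ 2) =
        Complex.exp (p ^ 2 * z ^ 2 + q ^ 2 / z ^ 2) * Complex.exp μ := by
      rw [← Complex.exp_add]; congr 1; rw [hμ]; push_cast; field_simp; ring
    have e3 : Complex.exp (-μ) * Complex.exp μ = 1 := by rw [← Complex.exp_add]; simp
    simp only [id]
    rw [e1, e2]
    set E := Complex.exp (p ^ 2 * z ^ 2 + q ^ 2 / z ^ 2)
    have e4 : (μ : ℂ) = 2 * p * q := by rw [hμ]; push_cast; ring
    have hrw : (μ - 1 : ℂ) * Complex.exp μ * (E * Complex.exp (-μ) * (p - -(q / z ^ 2))) -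
        (μ + 1) * Complex.exp (-μ) * (E * Complex.exp μ * (p + -(q / z ^ 2))) =
        (μ - 1 : ℂ) * (E * (p - -(q / z ^ 2))) - (μ + 1) * (E * (p + -(q / z ^ 2))) := by
      linear_combination ((μ - 1 : ℂ) * (E * (p - -(q / z ^ 2))) -
        (μ + 1) * (E * (p + -(q / z ^ 2)))) * e3
    rw [hrw, e4]
    field_simp
    ring
  · have hρ : 0 < ‖z‖ := norm_pos_iff.mpr hz
    set ρ := ‖z‖ with hρd
    set E := exp ((p ^ 2 * z ^ 2 + q ^ 2 / z ^ 2 : ℂ).re) with hE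
    have hinv : ((q : ℂ) / z).im = -(q * z.im / ρ ^ 2) := by
      rw [Complex.div_im]
      simp [Complex.normSq_eq_norm_sq, ← hρd]
    have hre : ∀ v : ℂ, v.re ^ 2 - v.im ^ 2 = (v ^ 2).re := fun v => by
      rw [sq v, Complex.mul_re]; ring
    have hv1 : 0 ≤ σ * (p * z - q / z).im := by
      rw [Complex.sub_im, hinv, Complex.im_ofReal_mul]
      have : σ * (p * z.im - -(q * z.im / ρ ^ 2)) = (σ * z.im) * (p + q / ρ ^ 2) := by ring
      rw [this]
      positivity
    have hv2 : 0 ≤ σ * (p * z + q / z).im := by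
      rw [Complex.add_im, hinv, Complex.im_ofReal_mul]
      have : σ * (p * z.im + -(q * z.im / ρ ^ 2)) = (σ * z.im) * (p - q / ρ ^ 2) := by ring
      rw [this]
      have : q / ρ ^ 2 ≤ p := by rwa [div_le_iff₀ (by positivity)]
      exact mul_nonneg hσz (by linarith)
    have hn : ‖(p : ℂ) * z‖ + ‖(q : ℂ) / z‖ = p * ρ + q / ρ := by
      rw [norm_mul, norm_div, Complex.norm_real, Complex.norm_real, Real.norm_of_nonneg hp.le,
        Real.norm_of_nonneg hq.le]
    have b1 := hGb _ σ hσ hv1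
    have b2 := hGb _ σ hσ hv2
    have r1 : |((p : ℂ) * z - q / z).re| ≤ p * ρ + q / ρ :=
      (Complex.abs_re_le_norm _).trans ((norm_sub_le _ _).trans hn.le)
    have r2 : |((p : ℂ) * z + q / z).re| ≤ p * ρ + q / ρ :=
      (Complex.abs_re_le_norm _).trans ((norm_add_le _ _).trans hn.le)
    have x1 : exp μ * exp (((p : ℂ) * z - q / z).re ^ 2 - ((p : ℂ) * z - q / z).im ^ 2) = E := by
      rw [← exp_add, hre, hE]
      congr 1
      have : ((p : ℂ) * z - q / z) ^ 2 = p ^ 2 * z ^ 2 + q ^ 2 / z ^ 2 - (μ : ℝ) := by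
        rw [hμ]; push_cast; field_simp; ring
      rw [this, Complex.sub_re, Complex.ofReal_re]; ring
    have x2 : exp (-μ) * exp (((p : ℂ) * z + q / z).re ^ 2 - ((p : ℂ) * z + q / z).im ^ 2) = E := by
      rw [← exp_add, hre, hE]
      congr 1
      have : ((p : ℂ) * z + q / z) ^ 2 = p ^ 2 * z ^ 2 + q ^ 2 / z ^ 2 + (μ : ℝ) := by
        rw [hμ]; push_cast; field_simp; ring
      rw [this, Complex.add_re, Complex.ofReal_re]; ring
    set g1 := G (p * z - q / z)
    set g2 := G (p * z + q / z)
    set W := p * ρ + q / ρ + √π / 2 with hW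
    have c1 : exp μ * ‖g1 - σ * (√π / 2 * Complex.I)‖ ≤ W * E := by
      rw [← x1]
      calc _ ≤ exp μ * _ := mul_le_mul_of_nonneg_left b1 (exp_pos _).le
        _ ≤ exp μ * (W * _) := by
          gcongr
          exact add_le_add_left r1 _
        _ = _ := by ring
    have c2 : exp (-μ) * ‖g2 - σ * (√π / 2 * Complex.I)‖ ≤ W * E := by
      rw [← x2]
      calc _ ≤ exp (-μ) * _ := mul_le_mul_of_nonneg_left b2 (exp_pos _).le
        _ ≤ exp (-μ) * (W * _) := by
          gcongr
          exact add_le_add_left r2 _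
        _ = _ := by ring
    have key : 1 / (p : ℂ) ^ 2 * (z * Complex.exp (p ^ 2 * z ^ 2 + q ^ 2 / z ^ 2) + 1 / (2 * p) *
        ((μ - 1) * Complex.exp μ * g1 - (μ + 1) * Complex.exp (-μ) * g2)) -
        σ * ((√π / (4 * p ^ 3) * ((μ - 1) * exp μ - (μ + 1) * exp (-μ)) : ℝ) * Complex.I) =
        1 / (p : ℂ) ^ 2 * (z * Complex.exp (p ^ 2 * z ^ 2 + q ^ 2 / z ^ 2) + 1 / (2 * p) *
        ((μ - 1) * Complex.exp μ * (g1 - σ * (√π / 2 * Complex.I)) -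
          (μ + 1) * Complex.exp (-μ) * (g2 - σ * (√π / 2 * Complex.I)))) := by
      push_cast
      field_simp
      ring
    rw [key]
    have n1 : ‖(1 : ℂ) / (p : ℂ) ^ 2‖ = 1 / p ^ 2 := by
      rw [norm_div, norm_pow, Complex.norm_real, Real.norm_of_nonneg hp.le, norm_one]
    have n2 : ‖(1 : ℂ) / (2 * p)‖ = 1 / (2 * p) := by
      rw [norm_div, norm_mul, Complex.norm_real, Real.norm_of_nonneg hp.le, norm_one]; simp
    have n3 : ‖(μ - 1 : ℂ) * Complex.exp μ * (g1 - σ * (√π / 2 * Complex.I))‖ ≤ (μ - 1) * (W * E) := by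
      have : ‖(μ - 1 : ℂ)‖ = μ - 1 := by
        rw [← Complex.ofReal_one, ← Complex.ofReal_sub, Complex.norm_real, Real.norm_of_nonneg (by linarith)]
      rw [norm_mul, norm_mul, this, Complex.norm_exp, Complex.ofReal_re, mul_assoc]
      exact mul_le_mul_of_nonneg_left c1 (by linarith)
    have n4 : ‖(μ + 1 : ℂ) * Complex.exp (-μ) * (g2 - σ * (√π / 2 * Complex.I))‖ ≤ (μ + 1) * (W * E) := by
      have : ‖(μ + 1 : ℂ)‖ = μ + 1 := by
        rw [← Complex.ofReal_one, ← Complex.ofReal_add, Complex.norm_real, Real.norm_of_nonneg (by linarith)]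
      rw [norm_mul, norm_mul, this, Complex.norm_exp, ← Complex.ofReal_neg, Complex.ofReal_re, mul_assoc]
      exact mul_le_mul_of_nonneg_left c2 (by linarith)
    have n5 : ‖z * Complex.exp (p ^ 2 * z ^ 2 + q ^ 2 / z ^ 2)‖ = ρ * E := by
      rw [norm_mul, Complex.norm_exp]
    rw [norm_mul, n1, mul_assoc (1 / p ^ 2)]
    refine mul_le_mul_of_nonneg_left ((norm_add_le _ _).trans ?_) (by positivity)
    rw [n5, norm_mul, n2]
    calc _ ≤ ρ * E + 1 / (2 * p) * ((μ - 1) * (W * E) + (μ + 1) * (W * E)) := by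
          gcongr
          exact (norm_sub_le _ _).trans (add_le_add n3 n4)
      _ = _ := by rw [hμ]; field_simp; ring

lemma re_csqrt_nonneg (w : ℂ) : 0 ≤ (Complex.sqrt w).re := by
  rw [Complex.sqrt, Complex.cpow_inv_two_re]
  positivity

lemma line_ne_zero {y : ℝ} (hy : 0 < y) (x : ℝ) : ((y : ℂ) - x * Complex.I) ≠ 0 := fun h => by
  have := congrArg Complex.re h
  simp at this
  exact hy.ne' this

lemma continuous_csqrt_mul_cexp {y : ℝ} (hy : 0 < y) (α β : ℂ) :
    Continuous fun x : ℝ => Complex.sqrt (y - x * Complex.I) *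
      Complex.exp (α * (y - x * Complex.I) + β / (y - x * Complex.I)) := by
  refine Continuous.mul ?_ ?_
  · exact continuous_iff_continuousAt.mpr fun x => (hasDerivAt_csqrt_line hy x).continuousAt
  · refine Complex.continuous_exp.comp (Continuous.add (by fun_prop) ?_)
    exact Continuous.div continuous_const (by fun_prop) (line_ne_zero hy)

lemma im_csqrt_line {y : ℝ} (hy : 0 < y) {σ x : ℝ} (h : σ * x < 0) :
    0 ≤ σ * (Complex.sqrt (y - x * Complex.I)).im := by
  have h1 := congrArg Complex.im (sqrt_sq' (line_ne_zero hy x))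
  have h2 := re_csqrt_nonneg (y - x * Complex.I)
  set z := Complex.sqrt (y - x * Complex.I)
  rw [sq, Complex.mul_im] at h1
  simp at h1
  by_contra! h3
  have h4 : σ * (z.re * z.im + z.im * z.re) = -(σ * x) := by rw [h1]; ring
  nlinarith [mul_nonneg h2 (neg_nonneg.mpr h3.le)]

lemma endpoint_bound {s p q ρ : ℝ} (hs : 100 ≤ s) (hq2 : q ^ 2 = π / 12)
    (hp2 : p ^ 2 = π * s ^ 2 / 12) (hμ : 2 * p * q = π * s / 6) (hρl : 0.7 ≤ ρ) (hρu : ρ ≤ 0.71)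
    (hsp : q * √π ≤ 0.91) (hp : 0 < p ^ 2) :
    1 / p ^ 2 * (ρ + 2 * q * (p * ρ + q / ρ + √π / 2)) ≤ 0.016 := by
  have hπ := pi_gt_d4
  have hπ' := pi_lt_d4
  have e : ρ + 2 * q * (p * ρ + q / ρ + √π / 2) =
      ρ + 2 * p * q * ρ + 2 * (q ^ 2 / ρ) + q * √π := by ring
  have e1 : q ^ 2 / ρ ≤ 0.375 := by
    rw [div_le_iff₀ (by linarith), hq2]; linarith
  have e2 : π * s / 6 * ρ ≤ 0.373 * s := by
    have : π / 6 * ρ ≤ 3.1416 / 6 * 0.71 := by gcongr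
    calc _ = (π / 6 * ρ) * s := by ring
      _ ≤ (3.1416 / 6 * 0.71) * s := by gcongr
      _ ≤ _ := by linarith
  have e3 : 3.1415 * s ^ 2 / 12 ≤ p ^ 2 := by rw [hp2]; gcongr
  have e4 : 100 * s ≤ s ^ 2 := by nlinarith
  rw [one_div_mul_eq_div, div_le_iff₀ hp, e, hμ]
  linarith

set_option maxHeartbeats 800000 in
lemma norm_integral_csqrt_sub_le {s y : ℝ} (hs : 100 ≤ s) (hy : 2 * s * y = 1) :
    ‖(∫ x in (-1 / 2 : ℝ)..(1 / 2), Complex.sqrt (y - x * Complex.I) *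
        Complex.exp (π * s ^ 2 / 12 * (y - x * Complex.I) + π / 12 / (y - x * Complex.I))) -
      ((√12 / s ^ 2 * (1 - 6 / (π * s)) * exp (π * s / 6) : ℝ) : ℂ)‖ ≤ exp (π * s / 24) := by
  have hs0 : 0 < s := by linarith
  have hy0 : 0 < y := by
    by_contra! h
    nlinarith
  have hy1 : y ≤ 1 / 200 := by nlinarith
  have hπ := pi_gt_d4
  have hπ' := pi_lt_d4
  set q := √(π / 12) with hq
  have hq0 : 0 < q := by rw [hq]; positivity
  have hq2 : q ^ 2 = π / 12 := sq_sqrt (by positivity)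
  have hqh : 1 / 2 ≤ q := by
    rw [hq]; apply le_sqrt_of_sq_le; norm_num; linarith
  set p := s * q with hp
  have hp0 : 0 < p := by positivity
  have hp1 : 1 ≤ p := by rw [hp]; nlinarith
  have hp2 : p ^ 2 = π * s ^ 2 / 12 := by rw [hp, mul_pow, hq2]; ring
  have hμ : 2 * p * q = π * s / 6 := by
    rw [hp]; linear_combination 2 * s * hq2
  obtain ⟨Φ, hΦ, hb⟩ := exists_primitive_sq_mul_exp hp0 hq0 (by rw [hμ]; nlinarith)
  rw [hμ] at hb
  set C := √π / (4 * p ^ 3) * ((π * s / 6 - 1) * exp (π * s / 6) -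
    (π * s / 6 + 1) * exp (-(π * s / 6))) with hC
  have hsplit : (∫ x in (-1 / 2 : ℝ)..(1 / 2), Complex.sqrt (y - x * Complex.I) *
        Complex.exp (π * s ^ 2 / 12 * (y - x * Complex.I) + π / 12 / (y - x * Complex.I))) =
      Complex.I * Φ (Complex.sqrt (y - (1 / 2 : ℝ) * Complex.I)) -
        Complex.I * Φ (Complex.sqrt (y - (-1 / 2 : ℝ) * Complex.I)) := by
    refine intervalIntegral.integral_eq_sub_of_hasDerivAt
      (f := fun x : ℝ => Complex.I * Φ (Complex.sqrt (y - x * Complex.I))) (fun x _ => ?_)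
      ((continuous_csqrt_mul_cexp hy0 _ _).intervalIntegrable _ _)
    have hw := line_ne_zero hy0 x
    have hz := csqrt_ne_zero hw
    have := (HasDerivAt.comp x (hΦ _ hz) (hasDerivAt_csqrt_line hy0 x)).const_mul Complex.I
    refine this.congr_deriv ?_
    have hz2 := sqrt_sq' hw
    have e1 : (p : ℂ) ^ 2 = π * s ^ 2 / 12 := by exact_mod_cast hp2
    have e2 : (q : ℂ) ^ 2 = π / 12 := by exact_mod_cast hq2
    rw [hz2, e1, e2]
    set z := Complex.sqrt (y - x * Complex.I)
    rw [← hz2]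
    field_simp
    linear_combination -Complex.I_mul_I
  have hend : ∀ x σ : ℝ, (σ = 1 ∨ σ = -1) → x = -σ / 2 →
      ‖Φ (Complex.sqrt (y - x * Complex.I)) - σ * (C * Complex.I)‖ ≤ 0.017 * exp (π * s / 24) := by
    intro x σ hσ hx
    have hσ2 : σ ^ 2 = 1 := by rcases hσ with rfl | rfl <;> norm_num
    have hw := line_ne_zero hy0 x
    have hz := csqrt_ne_zero hw
    have hnz : 0 < ‖(y - x * Complex.I : ℂ)‖ := norm_pos_iff.mpr hw
    have hρ2 : ‖Complex.sqrt (y - x * Complex.I)‖ ^ 2 = ‖(y - x * Complex.I : ℂ)‖ := by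
      rw [norm_csqrt hw, sq_sqrt (norm_nonneg _)]
    have hρ0 : 0 < ‖Complex.sqrt (y - x * Complex.I)‖ := norm_pos_iff.mpr hz
    have hn : ‖(y - x * Complex.I : ℂ)‖ ^ 2 = y ^ 2 + 1 / 4 := by
      rw [← Complex.normSq_eq_norm_sq, Complex.normSq_apply]
      simp
      rw [hx]
      linear_combination 1 / 4 * hσ2
    have hz2 := sqrt_sq' hw
    have him : 0 ≤ σ * (Complex.sqrt (y - x * Complex.I)).im :=
      im_csqrt_line hy0 (by rw [hx]; linarith)
    have hhalf : 1 / 2 ≤ ‖(y - x * Complex.I : ℂ)‖ := by nlinarith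
    have h := hb _ σ hz hσ him (by rw [hρ2, hp]; nlinarith)
    refine h.trans ?_
    have hre : (((p : ℂ) ^ 2 * Complex.sqrt (y - x * Complex.I) ^ 2 +
        q ^ 2 / Complex.sqrt (y - x * Complex.I) ^ 2 : ℂ)).re ≤ π * s / 24 + π / 3 * y := by
      have hdiv : ∀ Q : ℝ, ((Q : ℂ) / (y - x * Complex.I)).re = Q * y / (y ^ 2 + 4⁻¹) := by
        intro Q
        rw [Complex.div_re]
        simp [Complex.normSq_eq_norm_sq, hn]
      rw [hz2, ← Complex.ofReal_pow, ← Complex.ofReal_pow, Complex.add_re, Complex.re_ofReal_mul,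
        hdiv, hp2, hq2]
      have hwre : ((y : ℂ) - x * Complex.I).re = y := by simp
      rw [hwre]
      have e1 : π * s ^ 2 / 12 * y = π * s / 24 := by linear_combination π * s / 24 * hy
      have e2 : π / 12 * y / (y ^ 2 + 4⁻¹) ≤ π / 3 * y := by
        rw [div_le_iff₀ (by positivity)]
        have : 0 ≤ π * y ^ 3 := by positivity
        nlinarith
      linarith
    have hexp : exp ((((p : ℂ) ^ 2 * Complex.sqrt (y - x * Complex.I) ^ 2 +
        q ^ 2 / Complex.sqrt (y - x * Complex.I) ^ 2 : ℂ)).re) ≤ 1.01 * exp (π * s / 24) := by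
      refine (exp_le_exp.mpr hre).trans ?_
      rw [exp_add, mul_comm]
      gcongr
      have h1 : π / 3 * y ≤ 0.006 := by nlinarith
      refine (exp_le_exp.mpr h1).trans ?_
      have := exp_bound' (x := 0.006) (by norm_num) (by norm_num) (n := 2) (by norm_num)
      refine this.trans ?_
      norm_num [Finset.sum_range_succ]
    set ρ := ‖Complex.sqrt (y - x * Complex.I)‖
    have hρl : 0.7 ≤ ρ := by nlinarith
    have hρu : ρ ≤ 0.71 := by
      by_contra! hh
      have : 0.504 ≤ ρ ^ 2 := by nlinarith
      rw [hρ2] at this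
      nlinarith
    have hsp : q * √π ≤ 0.91 := by
      refine le_of_sq_le_sq ?_ (by norm_num)
      rw [mul_pow, hq2, sq_sqrt pi_pos.le]
      nlinarith
    have hB : 1 / p ^ 2 * (ρ + 2 * q * (p * ρ + q / ρ + √π / 2)) ≤ 0.016 := by
      exact endpoint_bound hs hq2 hp2 hμ hρl hρu hsp (by positivity)
    calc _ ≤ 0.016 * (1.01 * exp (π * s / 24)) := by gcongr
      _ ≤ _ := by nlinarith [exp_pos (π * s / 24)]
  have b1 := hend (1 / 2) (-1) (Or.inr rfl) (by norm_num)
  have b2 := hend (-1 / 2) 1 (Or.inl rfl) (by norm_num)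
  set z1 := Φ (Complex.sqrt (y - (1 / 2 : ℝ) * Complex.I))
  set z2 := Φ (Complex.sqrt (y - (-1 / 2 : ℝ) * Complex.I))
  have hM : √12 / s ^ 2 * (1 - 6 / (π * s)) * exp (π * s / 6) =
      √π / (2 * p ^ 3) * (π * s / 6 - 1) * exp (π * s / 6) := by
    congr 1
    have h12 : √12 * q = √π := by
      rw [hq, ← sqrt_mul (by norm_num)]; congr 1; ring
    have : p ^ 3 = s ^ 3 * (π / 12) * q := by rw [hp, ← hq2]; ring
    rw [this, ← h12]
    field_simp
    ring
  have key : (Complex.I * z1 - Complex.I * z2) -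
      ((√12 / s ^ 2 * (1 - 6 / (π * s)) * exp (π * s / 6) : ℝ) : ℂ) =
      Complex.I * (z1 - (-1 : ℝ) * (C * Complex.I)) - Complex.I * (z2 - (1 : ℝ) * (C * Complex.I)) -
        ((√π / (2 * p ^ 3) * ((π * s / 6 + 1) * exp (-(π * s / 6))) : ℝ) : ℂ) := by
    rw [hM, hC]
    push_cast
    linear_combination (-2 * (√π / (4 * p ^ 3) * ((π * s / 6 - 1) * Complex.exp (π * s / 6) -
      (π * s / 6 + 1) * Complex.exp (-(π * s / 6)))) : ℂ) * Complex.I_mul_I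
  rw [hsplit, key]
  have hsmall : √π / (2 * p ^ 3) * ((π * s / 6 + 1) * exp (-(π * s / 6))) ≤ 0.9 := by
    have h1 : (π * s / 6 + 1) * exp (-(π * s / 6)) ≤ 1 := by
      rw [exp_neg, ← div_eq_mul_inv, div_le_one (exp_pos _)]
      exact add_one_le_exp _
    have h2 : √π ≤ 1.8 := by
      rw [sqrt_le_left (by norm_num)]; norm_num; linarith
    have h3 : 1 ≤ p ^ 3 := one_le_pow₀ hp1
    have h4 : √π / (2 * p ^ 3) ≤ 0.9 := by
      rw [div_le_iff₀ (by positivity)]; linarith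
    have h5 : 0 ≤ √π / (2 * p ^ 3) := by positivity
    nlinarith
  have hnn : 0 ≤ √π / (2 * p ^ 3) * ((π * s / 6 + 1) * exp (-(π * s / 6))) := by positivity
  have hE : 1 ≤ exp (π * s / 24) := one_le_exp (by positivity)
  refine (norm_sub_le _ _).trans ?_
  rw [Complex.norm_real, Real.norm_of_nonneg hnn]
  have := norm_sub_le (Complex.I * (z1 - (-1 : ℝ) * (C * Complex.I)))
    (Complex.I * (z2 - (1 : ℝ) * (C * Complex.I)))
  rw [norm_mul, norm_mul, Complex.norm_I, one_mul, one_mul] at this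
  linarith

lemma continuous_eulerProd_line {y : ℝ} (hy : 0 < y) :
    Continuous fun x : ℝ => (eulerProd (Complex.exp (2 * π * Complex.I * (x + y * Complex.I))))⁻¹ := by
  have hq : ∀ x : ℝ, ‖Complex.exp (2 * π * Complex.I * (x + y * Complex.I))‖ < 1 := fun x =>
    norm_cexp_lt_one (by simpa using hy)
  refine Continuous.inv₀ ?_ fun x => eulerProd_ne_zero (hq x)
  refine continuous_iff_continuousAt.mpr fun x => ?_
  exact ContinuousAt.comp (f := fun x : ℝ => Complex.exp (2 * π * Complex.I * (x + y * Complex.I)))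
    (differentiableAt_eulerProd (hq x)).continuousAt (by fun_prop)

lemma abs_card_partition_sub_le {n : ℕ} {s y : ℝ} (hs : 100 ≤ s) (hsn : s ^ 2 = 24 * n - 1)
    (hy : 2 * s * y = 1) :
    |(Fintype.card (Nat.Partition n) : ℝ) - √12 / s ^ 2 * (1 - 6 / (π * s)) * exp (π * s / 6)| ≤
      exp (π * s / 24) * (3 + 1.005 * √√(1.16 * y) * exp (2 * π * s / 108) +
        1.005 * (√2 * √y * exp (π * s / 24)) * (y * √(π / (π * s / 24 - 2.7)))) := by
  have hy0 : 0 < y := by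
    by_contra! h
    nlinarith
  have hy1 : y ≤ 1 / 200 := by nlinarith
  have hA : π / (48 * y) = π * s / 24 := by
    rw [div_eq_iff (by positivity)]
    linear_combination -π * hy
  have hA' : π / (108 * y) = 2 * π * s / 108 := by
    rw [div_eq_iff (by positivity)]
    linear_combination -π * hy
  have hA2 : 2.7 < π * s / 24 := by nlinarith [pi_gt_d4]
  set M := √12 / s ^ 2 * (1 - 6 / (π * s)) * exp (π * s / 6)
  have hM := norm_integral_csqrt_sub_le hs hy
  have hP := card_partition_eq_integral n hy0
  set F := fun x : ℝ => Complex.sqrt (y - x * Complex.I) *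
        Complex.exp (π * s ^ 2 / 12 * (y - x * Complex.I) + π / 12 / (y - x * Complex.I)) with hF
  set P := fun x : ℝ => Complex.exp (-(2 * π * Complex.I * n * (x + y * Complex.I))) *
        (eulerProd (Complex.exp (2 * π * Complex.I * (x + y * Complex.I))))⁻¹ with hPd
  have hFi : IntervalIntegrable F MeasureTheory.volume (-1 / 2) (1 / 2) :=
    (continuous_csqrt_mul_cexp hy0 _ _).intervalIntegrable _ _
  have hPi : IntervalIntegrable P MeasureTheory.volume (-1 / 2) (1 / 2) :=
    (Continuous.mul (by fun_prop) (continuous_eulerProd_line hy0)).intervalIntegrable _ _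
  have hc : Continuous fun x : ℝ => cuspBound y ((x - 1 / 2) / y) + cuspBound y ((x + 1 / 2) / y) :=
    ((continuous_cuspBound y).comp (by fun_prop)).add ((continuous_cuspBound y).comp (by fun_prop))
  have hbound : ‖∫ x in (-1 / 2 : ℝ)..(1 / 2), (P x - F x)‖ ≤
      ∫ x in (-1 / 2 : ℝ)..(1 / 2), exp (π * s / 24) * (2 + 1.005 * √√(1.16 * y) * exp (π / (108 * y)) +
        1.005 * (√2 * √y * exp (π / (48 * y))) *
          (cuspBound y ((x - 1 / 2) / y) + cuspBound y ((x + 1 / 2) / y))) := by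
    refine intervalIntegral.norm_integral_le_of_norm_le (by norm_num) (Eventually.of_forall fun x hx => ?_)
      (Continuous.intervalIntegrable (continuous_const.mul (continuous_const.add (continuous_const.mul hc))) _ _)
    have hx' : |x| ≤ 1 / 2 := abs_le.mpr ⟨by linarith [hx.1], hx.2⟩
    have h := norm_eta_inv_sub_le hy0 hy1 hx'
    have e : P x - F x = Complex.exp (π * s ^ 2 / 12 * (y - x * Complex.I)) *
        ((ModularForm.eta (x + y * Complex.I))⁻¹ -
          Complex.sqrt (y - x * Complex.I) * Complex.exp (π / 12 / (y - x * Complex.I))) := by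
      have hsc : (s : ℂ) ^ 2 = 24 * n - 1 := by exact_mod_cast hsn
      have he : Complex.exp (-(2 * π * Complex.I * n * (x + y * Complex.I))) =
          Complex.exp (π * s ^ 2 / 12 * (y - x * Complex.I)) *
            Complex.exp (-(2 * π * Complex.I * (x + y * Complex.I) / 24)) := by
        rw [← Complex.exp_add, hsc]
        congr 1
        linear_combination (-2 * π * y * n + π * y / 12) * Complex.I_mul_I
      simp only [hPd, hF]
      rw [eta_inv_eq, he, Complex.exp_add]
      ring
    rw [e, norm_mul, Complex.norm_exp]
    have e2 : ((π * s ^ 2 / 12 * (y - x * Complex.I) : ℂ)).re = π * s / 24 := by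
      have : (π * s ^ 2 / 12 : ℂ) = ((π * s ^ 2 / 12 : ℝ) : ℂ) := by push_cast; ring
      rw [this, Complex.re_ofReal_mul]
      simp
      linear_combination π * s / 24 * hy
    rw [e2]
    exact mul_le_mul_of_nonneg_left h (exp_pos _).le
  have hsplit : ∀ c d : ℝ, ∫ x in (-1 / 2 : ℝ)..(1 / 2),
      (c + d * (cuspBound y ((x - 1 / 2) / y) + cuspBound y ((x + 1 / 2) / y))) =
      c + d * ∫ x in (-1 / 2 : ℝ)..(1 / 2), (cuspBound y ((x - 1 / 2) / y) + cuspBound y ((x + 1 / 2) / y)) := by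
    intro c d
    rw [intervalIntegral.integral_add (by simp) ((hc.const_mul d).intervalIntegrable _ _),
      intervalIntegral.integral_const_mul, intervalIntegral.integral_const]
    norm_num
  rw [intervalIntegral.integral_sub hPi hFi, hP, intervalIntegral.integral_const_mul, hsplit, hA,
    hA'] at hbound
  have hcusp := integral_cuspBound_add_le hy0 (by rw [hA]; exact hA2)
  rw [hA] at hcusp
  have hfin : ‖((Fintype.card (Nat.Partition n) : ℂ) - ((M : ℝ) : ℂ))‖ ≤ _ :=
    (norm_sub_le_norm_sub_add_norm_sub _ (∫ x in (-1 / 2 : ℝ)..(1 / 2), F x) _).trans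
      (add_le_add hbound hM)
  rw [← Complex.ofReal_natCast, ← Complex.ofReal_sub, Complex.norm_real, Real.norm_eq_abs] at hfin
  refine hfin.trans ?_
  have := mul_le_mul_of_nonneg_left hcusp
    (by positivity : 0 ≤ exp (π * s / 24) * (1.005 * (√2 * √y * exp (π * s / 24))))
  linarith

/-- The leading term of the Hardy-Ramanujan-Rademacher series for `p n`. -/
noncomputable def mainTerm (n : ℕ) : ℝ :=
  √12 / √(24 * n - 1) ^ 2 * (1 - 6 / (π * √(24 * n - 1))) * exp (π * √(24 * n - 1) / 6)

lemma sq_le_two_mul_exp {s : ℝ} (hs : 138.5 ≤ s) : s ^ 2 ≤ 2 * exp (5 * π * s / 216) := by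
  have hπ := pi_gt_d4
  have hu : 0.0727 * s ≤ 5 * π * s / 216 := by nlinarith
  have h1 : exp (0.0727 * s - 10) * exp 1 ^ 10 ≤ exp (5 * π * s / 216) := by
    rw [← exp_nat_mul, ← exp_add, exp_le_exp]
    push_cast
    linarith
  have h2 : (20000 : ℝ) ≤ exp 1 ^ 10 := by
    calc (20000 : ℝ) ≤ 2.7 ^ 10 := by norm_num
      _ ≤ _ := by
        have := exp_one_gt_d9
        gcongr
        linarith
  have h3 : 0.0727 * s - 10 + 1 ≤ exp (0.0727 * s - 10) := add_one_le_exp _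
  have h4 := quadratic_le_exp_of_nonneg (x := 0.0727 * s - 10) (by linarith)
  have h5 : (1 + (0.0727 * s - 10) + (0.0727 * s - 10) ^ 2 / 2) * 20000 ≤ exp (5 * π * s / 216) :=
    le_trans (by gcongr) h1
  nlinarith

lemma abs_card_partition_sub_mainTerm_lt_of_large {n : ℕ} (hn : 800 ≤ n) :
    |(Fintype.card (Nat.Partition n) : ℝ) - mainTerm n| <
      exp (π / 2 * √(2 * n / 3)) / (4 * √3 * n) := by
  have hn' : (800 : ℝ) ≤ n := by exact_mod_cast hn
  have hπ := pi_gt_d4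
  have hπ' := pi_lt_d4
  rw [mainTerm]
  set s := √(24 * n - 1) with hsd
  have hs2 : s ^ 2 = 24 * n - 1 := sq_sqrt (by linarith)
  have hs0 : 0 ≤ s := sqrt_nonneg _
  have hs : 138.5 ≤ s := by
    rw [hsd]; apply le_sqrt_of_sq_le; norm_num; linarith
  have h := abs_card_partition_sub_le (n := n) (s := s) (y := 1 / (2 * s)) (by linarith) hs2
    (by field_simp)
  refine h.trans_lt ?_
  set X := exp (π * s / 24) with hX
  set V := exp (2 * π * s / 108) with hV
  set U := exp (5 * π * s / 216) with hU
  have hXUV : X = U * V := by rw [hX, hU, hV, ← exp_add]; congr 1; ring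
  have hX2 : X * X ≤ exp (π / 2 * √(2 * n / 3)) := by
    rw [hX, ← exp_add, exp_le_exp]
    have : s ≤ 6 * √(2 * n / 3) := by
      rw [hsd]
      apply sqrt_le_iff.mpr ⟨by positivity, ?_⟩
      rw [mul_pow, sq_sqrt (by positivity)]
      linarith
    nlinarith
  have hsU : s ^ 2 ≤ 2 * U := sq_le_two_mul_exp hs
  have hV41 : 41 ≤ V := by
    have h8 : (8 : ℝ) ≤ 2 * π * s / 108 := by nlinarith
    have := quadratic_le_exp_of_nonneg (x := 2 * π * s / 108) (by linarith)
    nlinarith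
  have hVX : V * s ^ 2 ≤ 2 * X := by
    rw [hXUV]; nlinarith
  have hX0 : 0 < X := exp_pos _
  have hq : √√(1.16 * (1 / (2 * s))) ≤ 0.255 := by
    rw [sqrt_le_left (by norm_num), sqrt_le_left (by norm_num), one_div, ← div_eq_mul_inv,
      div_le_iff₀ (by positivity)]
    norm_num
    linarith
  have hT : √2 * √(1 / (2 * s)) * (1 / (2 * s)) * √(π / (π * s / 24 - 2.7)) ≤ 2.66 / s ^ 2 := by
    have hA : 0.1113 * s ≤ π * s / 24 - 2.7 := by nlinarith
    have e : √2 * √(1 / (2 * s)) * (1 / (2 * s)) * √(π / (π * s / 24 - 2.7)) =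
        √(1 / s * (π / (π * s / 24 - 2.7))) / (2 * s) := by
      rw [← sqrt_mul (by norm_num), mul_assoc, mul_comm (1 / (2 * s)), ← mul_assoc,
        ← sqrt_mul (by positivity)]
      rw [show (2 : ℝ) * (1 / (2 * s)) = 1 / s by field_simp]
      ring
    rw [e]
    have h1 : √(1 / s * (π / (π * s / 24 - 2.7))) ≤ 5.32 / s := by
      rw [sqrt_le_left (by positivity)]
      calc 1 / s * (π / (π * s / 24 - 2.7)) ≤ 1 / s * (3.1416 / (0.1113 * s)) := by gcongr
        _ = (3.1416 / 0.1113) / s ^ 2 := by field_simp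
        _ ≤ 5.32 ^ 2 / s ^ 2 := by gcongr; norm_num
        _ = _ := by rw [div_pow]
    calc _ ≤ 5.32 / s / (2 * s) := by gcongr
      _ = _ := by field_simp; norm_num
  have h3 : 1.732 ≤ √3 := by apply le_sqrt_of_sq_le; norm_num
  have key : 3 + 1.005 * √√(1.16 * (1 / (2 * s))) * V +
      1.005 * (√2 * √(1 / (2 * s)) * X) * (1 / (2 * s) * √(π / (π * s / 24 - 2.7))) <
      X / (4 * √3 * n) := by
    have hs2' : 0 < s ^ 2 := by positivity
    have a1 : 1.005 * √√(1.16 * (1 / (2 * s))) * V ≤ 0.2563 * V := by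
      have : 0 ≤ V := by linarith
      gcongr
      linarith
    have a2 : 1.005 * (√2 * √(1 / (2 * s)) * X) * (1 / (2 * s) * √(π / (π * s / 24 - 2.7))) ≤
        2.674 * (X / s ^ 2) := by
      calc _ = 1.005 * X * (√2 * √(1 / (2 * s)) * (1 / (2 * s)) * √(π / (π * s / 24 - 2.7))) := by ring
        _ ≤ 1.005 * X * (2.66 / s ^ 2) := by gcongr
        _ = 1.005 * 2.66 * (X / s ^ 2) := by ring
        _ ≤ _ := by gcongr; norm_num
    have a3 : V ≤ 2 * (X / s ^ 2) := by
      rw [mul_div_assoc', le_div_iff₀ hs2']; exact hVX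
    have a4 : 3.4 * (X / s ^ 2) < X / (4 * √3 * n) := by
      rw [mul_div_assoc', div_lt_div_iff₀ hs2' (by positivity), hs2]
      have : √3 * √3 = 3 := mul_self_sqrt (by norm_num)
      have h31 : √3 ≤ 1.7321 := by rw [sqrt_le_left (by norm_num)]; norm_num
      have : 3.4 * (4 * √3 * n) < 24 * n - 1 := by nlinarith
      nlinarith
    have a5 : 0 < X / s ^ 2 := by positivity
    linarith
  calc _ < X * (X / (4 * √3 * n)) := by gcongr
    _ = X * X / (4 * √3 * n) := by ring
    _ ≤ _ := by gcongr

/-- `p (n - g)`, read as `0` when `g > n`. -/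
def partAt (n g : ℕ) : ℕ := if g ≤ n then Fintype.card (Nat.Partition (n - g)) else 0

lemma pentagonal_large {k : ℤ} (hk : k ∉ Icc (-23 : ℤ) 23) : 800 ≤ pentagonal k := by
  have h := two_mul_natCast_pentagonal k
  rw [Finset.mem_Icc] at hk
  have : (800 : ℤ) ≤ pentagonal k := by
    rcases lt_or_ge k 0 with h0 | h0
    · have : k ≤ -24 := by omega
      nlinarith
    · have : 24 ≤ k := by omega
      nlinarith
  exact_mod_cast this

lemma sum_negOnePow_mul_partAt {n : ℕ} (hn : n ≠ 0) (hn' : n < 800) :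
    ∑ k ∈ Icc (-23 : ℤ) 23, (Int.negOnePow k : ℤ) * partAt n (pentagonal k) = 0 := by
  have h := antidiagonal_pentagonal n
  rw [if_neg hn, ← Finset.Nat.sum_antidiagonal_swap] at h
  simp only [Prod.fst_swap, Prod.snd_swap] at h
  rw [Finset.Nat.sum_antidiagonal_eq_sum_range_succ (fun a b => (Fintype.card (Nat.Partition b) : ℤ) *
      (PowerSeries.pentagonalSeries ℤ).coeff a)] at h
  rw [← h]
  refine Finset.sum_bij_ne_zero (fun k _ _ => pentagonal k) (fun k _ hk => ?_)
    (fun a _ _ b _ _ hab => pentagonal_injective hab) (fun j hj hj0 => ?_) (fun k _ hk => ?_)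
  · rw [Finset.mem_range]
    by_contra! hlt
    exact hk (by rw [partAt, if_neg (by omega)]; simp)
  · have hmem : j ∈ Set.range pentagonal := by
      by_contra hj1
      exact hj0 (by rw [PowerSeries.coeff_pentagonalSeries_eq_zero ℤ hj1, mul_zero])
    obtain ⟨k, rfl⟩ := hmem
    rw [Finset.mem_range] at hj
    refine ⟨k, ?_, ?_, rfl⟩
    · by_contra hk
      have := pentagonal_large hk
      omega
    · rw [PowerSeries.coeff_pentagonalSeries_pentagonal] at hj0
      rw [partAt, if_pos (by omega), mul_comm]
      simpa only [Int.cast_id] using hj0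
  · have hle : pentagonal k ≤ n := by
      by_contra hlt
      exact hk (by rw [partAt, if_neg hlt]; simp)
    rw [PowerSeries.coeff_pentagonalSeries_pentagonal, partAt, if_pos hle, mul_comm,
      Int.cast_id]

/-- The pentagonal numbers of odd index in `[-23, 23]`. -/
def oddOffsets : List ℕ :=
  [1, 2, 12, 15, 35, 40, 70, 77, 117, 126, 176, 187, 247, 260, 330, 345, 425, 442, 532, 551, 651,
    672, 782, 805]

/-- The pentagonal numbers of nonzero even index in `[-23, 23]`. -/
def evenOffsets : List ℕ :=
  [5, 7, 22, 26, 51, 57, 92, 100, 145, 155, 210, 222, 287, 301, 376, 392, 477, 495, 590, 610, 715,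
    737]

lemma card_add_sum_evenOffsets {n : ℕ} (hn : n ≠ 0) (hn' : n < 800) :
    Fintype.card (Nat.Partition n) + (evenOffsets.map (partAt n)).sum =
      (oddOffsets.map (partAt n)).sum := by
  have h := sum_negOnePow_mul_partAt hn hn'
  have he : (filter (fun k : ℤ => Even k) (Icc (-23 : ℤ) 23)).val.map pentagonal =
      ((0 :: evenOffsets : List ℕ) : Multiset ℕ) := by decide +kernel
  have ho : (filter (fun k : ℤ => ¬Even k) (Icc (-23 : ℤ) 23)).val.map pentagonal =
      ((oddOffsets : List ℕ) : Multiset ℕ) := by decide +kernel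
  have hsum (s : Finset ℤ) (l : List ℕ) (hl : s.val.map pentagonal = (l : Multiset ℕ)) :
      ∑ k ∈ s, partAt n (pentagonal k) = (l.map (partAt n)).sum := by
    rw [← Multiset.sum_coe, ← Multiset.map_coe, ← hl, Multiset.map_map]
    rfl
  have he' := hsum _ _ he
  rw [← hsum _ _ ho]
  rw [List.map_cons, List.sum_cons, partAt, if_pos (Nat.zero_le n), Nat.sub_zero] at he'
  rw [← he']
  rw [← Finset.sum_filter_add_sum_filter_not _ (fun k : ℤ => Even k),
    Finset.sum_congr rfl (g := fun k => (partAt n (pentagonal k) : ℤ)) (fun k hk => by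
      rw [Int.negOnePow_even k (Finset.mem_filter.mp hk).2]; simp),
    Finset.sum_congr (s₁ := filter (fun k : ℤ => ¬Even k) _) rfl
      (g := fun k => -(partAt n (pentagonal k) : ℤ)) (fun k hk => by
      rw [Int.negOnePow_odd k (Int.not_even_iff_odd.mp (Finset.mem_filter.mp hk).2)]; simp),
    Finset.sum_neg_distrib] at h
  zify
  linarith

/-- `force n f = f n`, written so that the kernel evaluates `n` to a numeral first. -/
def force {α : Type} (n : ℕ) (f : ℕ → α) : α :=
  Nat.rec (motive := fun _ => α) (f 0) (fun k _ => f (k + 1)) n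

@[simp] lemma force_eq {α : Type} (n : ℕ) (f : ℕ → α) : force n f = f n := by
  cases n <;> rfl

/-- The digit of `Q` in base `2 ^ 100` at position `g - 1`. -/
def digitAt (Q g : ℕ) : ℕ := Q / 2 ^ (100 * (g - 1)) % 2 ^ 100

/-- The base `2 ^ 100` digits of `Q` are `p (n - 1), p (n - 2), …, p 0`. -/
def IsHistory (n Q : ℕ) : Prop :=
  ∀ j, Q / 2 ^ (100 * j) % 2 ^ 100 =
    if j < n then Fintype.card (Nat.Partition (n - 1 - j)) else 0

/-- Euler's pentagonal recurrence read off from the digits of `Q`. -/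
def nextValue (Q : ℕ) : ℕ :=
  (oddOffsets.map (digitAt Q)).sum - (evenOffsets.map (digitAt Q)).sum

lemma IsHistory.digitAt_eq {n Q : ℕ} (h : IsHistory n Q) {g : ℕ} (hg : 1 ≤ g) :
    digitAt Q g = partAt n g := by
  rw [digitAt, h (g - 1), partAt]
  by_cases hgn : g ≤ n
  · rw [if_pos hgn, if_pos (by omega), show n - 1 - (g - 1) = n - g by omega]
  · rw [if_neg hgn, if_neg (by omega)]

lemma IsHistory.nextValue_eq {n Q : ℕ} (h : IsHistory n Q) (hn : n ≠ 0) (hn' : n < 800) :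
    nextValue Q = Fintype.card (Nat.Partition n) := by
  have hmap (l : List ℕ) (hl : ∀ g ∈ l, 1 ≤ g) : l.map (digitAt Q) = l.map (partAt n) :=
    List.map_congr_left fun g hg => h.digitAt_eq (hl g hg)
  rw [nextValue, hmap _ (by decide), hmap _ (by decide)]
  have := card_add_sum_evenOffsets hn hn'
  omega

lemma isHistory_one : IsHistory 1 1 := by
  intro j
  rcases j with _ | j
  · simp
  · rw [if_neg (by omega), Nat.div_eq_of_lt (Nat.one_lt_two_pow (by omega)), Nat.zero_mod]

lemma IsHistory.succ {n Q : ℕ} (h : IsHistory n Q)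
    (hv : Fintype.card (Nat.Partition n) < 2 ^ 100) :
    IsHistory (n + 1) (Q * 2 ^ 100 + Fintype.card (Nat.Partition n)) := by
  intro j
  rcases j with _ | j
  · rw [mul_zero, pow_zero, Nat.div_one, Nat.mul_comm, Nat.mul_add_mod, Nat.mod_eq_of_lt hv]
    simp
  · rw [show 100 * (j + 1) = 100 + 100 * j by ring, pow_add, ← Nat.div_div_eq_div_mul,
      Nat.mul_comm Q, Nat.mul_add_div (by positivity), Nat.div_eq_of_lt hv, add_zero, h j]
    by_cases hj : j < n
    · rw [if_pos hj, if_pos (by omega), show n + 1 - 1 - (j + 1) = n - 1 - j by omega]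
    · rw [if_neg hj, if_neg (by omega)]

/-- Run `test m (p m)` for `n ≤ m < n + k`, where `Q` encodes the values of `p` below `n`. -/
def testAll (test : ℕ → ℕ → Bool) : ℕ → ℕ → ℕ → Bool
  | 0, _, _ => true
  | k + 1, n, Q => force (nextValue Q) fun v =>
      (Nat.blt v (2 ^ 100) && test n v) &&
        force (n + 1) fun n' => force (Q * 2 ^ 100 + v) fun Q' => testAll test k n' Q'

lemma test_of_testAll {test : ℕ → ℕ → Bool} {k : ℕ} : ∀ {n Q : ℕ}, testAll test k n Q = true →
    IsHistory n Q → n ≠ 0 → n + k ≤ 800 → ∀ m, n ≤ m → m < n + k →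
    test m (Fintype.card (Nat.Partition m)) = true := by
  induction k with
  | zero => intros; omega
  | succ k ih =>
    intro n Q ht h hn hk m hnm hmk
    simp only [testAll, force_eq, Bool.and_eq_true, h.nextValue_eq hn (by omega),
      Nat.blt_eq] at ht
    obtain ⟨⟨hv, htn⟩, ht'⟩ := ht
    rcases hnm.eq_or_lt with rfl | hlt
    · exact htn
    · exact ih ht' (h.succ hv) (by omega) (by omega) m hlt (by omega)

/-- `k` steps of integer Newton iteration for the square root of `X`. -/
def newtonSqrt (X : ℕ) : ℕ → ℕ → ℕ
  | 0, a => a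
  | k + 1, a => force ((a + X / a) / 2) (newtonSqrt X k)

/-- `k` fixed-point squarings with denominator `D`, each followed by adding `c`. -/
def squareIter (D c : ℕ) : ℕ → ℕ → ℕ
  | 0, a => a
  | k + 1, a => force (a * a / D + c) (squareIter D c k)

/-- Integer inequalities certifying the estimate for `p n = q`, given fixed-point bounds. -/
def Certified (D n q m s r tl tu x el eu : ℕ) : Prop :=
  s * s ≤ m * D * D ∧ m * D * D ≤ (s + 1) * (s + 1) ∧
  r * r ≤ 3 * m * D * D ∧ 3 * m * D * D ≤ (r + 1) * (r + 1) ∧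
  D ≤ tl ∧ x ≤ D ∧
  q * m * 314159265358979323847 * (r + 1) * (24 * n) * (D * D) <
    36 * 10 ^ 20 * (24 * n) * (tl - D) * (el * el) + 36 * 10 ^ 20 * m * tl * el * D ∧
  36 * 10 ^ 20 * (24 * n) * (tu - D) * (eu * eu) <
    q * m * 314159265358979323846 * r * (24 * n) * (D * D) + 36 * 10 ^ 20 * m * tl * el * D

instance (D n q m s r tl tu x el eu : ℕ) : Decidable (Certified D n q m s r tl tu x el eu) :=
  inferInstanceAs (Decidable (_ ∧ _))

/-- A fixed-point check of the estimate of `p n = q` by `mainTerm n`. -/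
def numericTest (n q : ℕ) : Bool :=
  force (2 ^ 200) fun D => force (24 * n - 1) fun m =>
  force (newtonSqrt (m * D * D) 14 (2 ^ 208)) fun s =>
  force (newtonSqrt (3 * m * D * D) 14 (2 ^ 208)) fun r =>
  force (314159265358979323846 * s / (6 * 10 ^ 20)) fun tl =>
  force (314159265358979323847 * (s + 1) / (6 * 10 ^ 20) + 1) fun tu =>
  force (tu / 2 ^ 81 + 1) fun x =>
  force (squareIter D 0 80 (D + tl / 2 ^ 81)) fun el =>
  force (squareIter D 1 80 (D + x + (x * x / D + 1))) fun eu =>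
  decide (Certified D n q m s r tl tu x el eu)

lemma testAll_numericTest : testAll numericTest 799 1 1 = true := by decide +kernel

lemma squareIter_zero_le {D : ℕ} (hD : 0 < D) (k : ℕ) : ∀ {a : ℕ} {y : ℝ},
    (a : ℝ) ≤ D * exp y → (squareIter D 0 k a : ℝ) ≤ D * exp (2 ^ k * y) := by
  induction k with
  | zero => intro a y h; simpa [squareIter] using h
  | succ k ih =>
    intro a y h
    rw [squareIter, force_eq, add_zero, pow_succ, mul_assoc]
    apply ih
    have hD' : (0 : ℝ) < D := by exact_mod_cast hD
    calc ((a * a / D : ℕ) : ℝ) ≤ (a * a : ℕ) / D := Nat.cast_div_le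
      _ ≤ (D * exp y) * (D * exp y) / D := by push_cast; gcongr
      _ = D * exp (2 * y) := by rw [two_mul, exp_add]; field_simp

lemma cast_div_le_natDiv_add_one {D : ℕ} (hD : 0 < D) (a : ℕ) :
    (a : ℝ) / D ≤ (a / D : ℕ) + 1 := by
  have hD' : (0 : ℝ) < D := by exact_mod_cast hD
  rw [div_le_iff₀ hD', mul_comm]
  exact_mod_cast (Nat.lt_mul_div_succ a hD).le

lemma le_squareIter_one {D : ℕ} (hD : 0 < D) (k : ℕ) : ∀ {a : ℕ} {y : ℝ},
    D * exp y ≤ (a : ℝ) → D * exp (2 ^ k * y) ≤ (squareIter D 1 k a : ℝ) := by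
  induction k with
  | zero => intro a y h; simpa [squareIter] using h
  | succ k ih =>
    intro a y h
    rw [squareIter, force_eq, pow_succ, mul_assoc]
    apply ih
    have hD' : (0 : ℝ) < D := by exact_mod_cast hD
    calc D * exp (2 * y) = (D * exp y) * (D * exp y) / D := by
          rw [two_mul, exp_add]; field_simp
      _ ≤ (a * a : ℕ) / D := by push_cast; gcongr
      _ ≤ ((a * a / D + 1 : ℕ) : ℝ) := by
          push_cast
          exact_mod_cast cast_div_le_natDiv_add_one hD (a * a)

lemma exp_le_one_add_add_sq {y : ℝ} (h0 : 0 ≤ y) (h1 : y ≤ 1) : exp y ≤ 1 + y + y ^ 2 := by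
  have := (abs_le.mp (abs_exp_sub_one_sub_id_le (x := y) (by rwa [abs_of_nonneg h0]))).2
  linarith

/-- Lower fixed-point approximation of `exp (t / 2)`. -/
lemma squareIter_le_exp_half {D tl : ℕ} (hD : 0 < D) {t : ℝ} (ht : (tl : ℝ) ≤ t * D) :
    (squareIter D 0 80 (D + tl / 2 ^ 81) : ℝ) ≤ D * exp (t / 2) := by
  have hD' : (0 : ℝ) < D := by exact_mod_cast hD
  have h := squareIter_zero_le hD 80 (a := D + tl / 2 ^ 81) (y := t / 2 ^ 81) ?_
  · rwa [show (2 : ℝ) ^ 80 * (t / 2 ^ 81) = t / 2 by ring] at h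
  · have h1 : ((tl / 2 ^ 81 : ℕ) : ℝ) ≤ (tl : ℝ) / 2 ^ 81 := by
      exact_mod_cast Nat.cast_div_le (α := ℝ) (m := tl) (n := 2 ^ 81)
    have h2 : (tl : ℝ) / 2 ^ 81 ≤ D * (t / 2 ^ 81) := by
      rw [show D * (t / 2 ^ 81) = t * D / 2 ^ 81 by ring]; gcongr
    have h3 := add_one_le_exp (t / 2 ^ 81)
    push_cast at h1 ⊢
    nlinarith

/-- Upper fixed-point approximation of `exp (t / 2)`. -/
lemma exp_half_le_squareIter {D tu x : ℕ} (hD : 0 < D) {t : ℝ} (ht0 : 0 ≤ t)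
    (ht : t * D ≤ tu) (hx : x = tu / 2 ^ 81 + 1) (hxD : x ≤ D) :
    D * exp (t / 2) ≤ (squareIter D 1 80 (D + x + (x * x / D + 1)) : ℝ) := by
  have hD' : (0 : ℝ) < D := by exact_mod_cast hD
  have h := le_squareIter_one hD 80 (a := D + x + (x * x / D + 1)) (y := t / 2 ^ 81) ?_
  · rwa [show (2 : ℝ) ^ 80 * (t / 2 ^ 81) = t / 2 by ring] at h
  · have h1 := cast_div_le_natDiv_add_one (D := 2 ^ 81) (by positivity) tu
    have h2 := cast_div_le_natDiv_add_one hD (x * x)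
    have hyx : D * (t / 2 ^ 81) ≤ x := by
      rw [show D * (t / 2 ^ 81) = t * D / 2 ^ 81 by ring, hx]
      push_cast at h1 ⊢
      refine le_trans ?_ h1
      gcongr
      norm_num
    have hy1 : t / 2 ^ 81 ≤ 1 := by
      have : (x : ℝ) ≤ D := by exact_mod_cast hxD
      nlinarith
    have h3 := exp_le_one_add_add_sq (by positivity) hy1
    have h4 : D * (t / 2 ^ 81) ^ 2 ≤ (x * x : ℕ) / D := by
      rw [le_div_iff₀ hD']
      push_cast
      calc D * (t / 2 ^ 81) ^ 2 * D = (D * (t / 2 ^ 81)) * (D * (t / 2 ^ 81)) := by ring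
        _ ≤ _ := by gcongr
    push_cast at h2 h4 ⊢
    nlinarith

lemma Certified.upper {D n q m s r tl tu x el eu : ℕ} (h : Certified D n q m s r tl tu x el eu)
    (hD : 0 < D) {ρ t E : ℝ} (ht : tl ≤ t * D) (hr : ρ * D ≤ r + 1) (hρ : 0 ≤ ρ)
    (hE : (el : ℝ) ≤ D * E) :
    q * m * (π * ρ) * (24 * n) < 36 * (24 * n) * (t - 1) * E ^ 2 + 36 * m * t * E := by
  obtain ⟨-, -, -, -, hDt, -, h, -⟩ := h
  have hD' : (0 : ℝ) < D := by exact_mod_cast hD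
  have hDt' : (D : ℝ) ≤ tl := by exact_mod_cast hDt
  have h' : (q : ℝ) * m * 314159265358979323847 * (r + 1) * (24 * n) * (D * D) <
    36 * 10 ^ 20 * (24 * n) * (tl - D) * (el * el) + 36 * 10 ^ 20 * m * tl * el * D := by
    rw [← Nat.cast_sub hDt]; exact_mod_cast h
  have hπ : π * 10 ^ 20 ≤ 314159265358979323847 := by
    have := pi_lt_d20
    linarith
  have hπ0 := pi_pos
  rw [← mul_lt_mul_iff_left₀ (show 0 < (D : ℝ) ^ 3 * 10 ^ 20 by positivity)]
  calc (q : ℝ) * m * (π * ρ) * (24 * n) * ((D : ℝ) ^ 3 * 10 ^ 20)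
      = q * m * (π * 10 ^ 20) * (ρ * D) * (24 * n) * (D * D) := by ring
    _ ≤ (q : ℝ) * m * 314159265358979323847 * (r + 1) * (24 * n) * (D * D) := by gcongr
    _ < _ := h'
    _ ≤ 36 * 10 ^ 20 * (24 * n) * (t * D - D) * ((D * E) * (D * E)) +
        36 * 10 ^ 20 * m * (t * D) * (D * E) * D := by
      have : 0 ≤ (tl : ℝ) - D := by linarith
      have : 0 ≤ t * D - D := by linarith
      have : 0 ≤ t * D := by linarith
      have : (0 : ℝ) ≤ D * E := le_trans (Nat.cast_nonneg _) hE
      gcongr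
    _ = _ := by ring

lemma Certified.lower {D n q m s r tl tu x el eu : ℕ} (h : Certified D n q m s r tl tu x el eu)
    (hD : 0 < D) {ρ t E : ℝ} (ht : tl ≤ t * D) (ht' : t * D ≤ tu) (hr : r ≤ ρ * D)
    (hE : (el : ℝ) ≤ D * E) (hE' : D * E ≤ eu) :
    36 * (24 * n) * (t - 1) * E ^ 2 < q * m * (π * ρ) * (24 * n) + 36 * m * t * E := by
  obtain ⟨-, -, -, -, hDt, -, -, h⟩ := h
  have hD' : (0 : ℝ) < D := by exact_mod_cast hD
  have hDt' : (D : ℝ) ≤ tl := by exact_mod_cast hDt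
  have hDu : D ≤ tu := by
    have : (D : ℝ) ≤ tu := by linarith
    exact_mod_cast this
  have h' : 36 * 10 ^ 20 * (24 * n) * ((tu : ℝ) - D) * (eu * eu) <
    q * m * 314159265358979323846 * r * (24 * n) * (D * D) +
      36 * 10 ^ 20 * m * tl * el * D := by
    rw [← Nat.cast_sub hDu]; exact_mod_cast h
  have hπ : 314159265358979323846 ≤ π * 10 ^ 20 := by
    have := pi_gt_d20
    linarith
  have hπ0 := pi_pos
  have hE0 : (0 : ℝ) ≤ D * E := le_trans (Nat.cast_nonneg _) hE
  rw [← mul_lt_mul_iff_left₀ (show 0 < (D : ℝ) ^ 3 * 10 ^ 20 by positivity)]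
  calc 36 * (24 * (n : ℝ)) * (t - 1) * E ^ 2 * ((D : ℝ) ^ 3 * 10 ^ 20)
      = 36 * 10 ^ 20 * (24 * n) * (t * D - D) * ((D * E) * (D * E)) := by ring
    _ ≤ 36 * 10 ^ 20 * (24 * (n : ℝ)) * (tu - D) * (eu * eu) := by
      have : 0 ≤ t * D - D := by linarith
      have : 0 ≤ (tu : ℝ) - D := by linarith
      gcongr
    _ < _ := h'
    _ ≤ (q : ℝ) * m * (π * 10 ^ 20) * (ρ * D) * (24 * n) * (D * D) +
        36 * 10 ^ 20 * m * (t * D) * (D * E) * D := by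
      have : 0 ≤ t * D := by linarith
      gcongr
    _ = _ := by ring

/-- The estimate certified by `numericTest`. -/
lemma abs_sub_lt_of_numericTest {n q : ℕ} (hn : 1 ≤ n) (h : numericTest n q = true) {σ t : ℝ}
    (hσ : σ = √(24 * n - 1)) (ht : t = π * σ / 6) :
    |q * (24 * n - 1) * (π * (√3 * σ)) * (24 * n) - 36 * (24 * n) * (t - 1) * exp (t / 2) ^ 2| <
      36 * (24 * n - 1) * t * exp (t / 2) := by
  simp only [numericTest, force_eq, decide_eq_true_eq] at h
  have hn' : (1 : ℝ) ≤ n := by exact_mod_cast hn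
  have hm : ((24 * n - 1 : ℕ) : ℝ) = 24 * n - 1 := by
    rw [Nat.cast_sub (by omega)]; push_cast; ring
  have hD : 0 < 2 ^ 200 := by positivity
  generalize 2 ^ 200 = D at h hD
  generalize 24 * n - 1 = m at h hm
  generalize newtonSqrt (m * D * D) 14 (2 ^ 208) = s at h
  generalize newtonSqrt (3 * m * D * D) 14 (2 ^ 208) = r at h
  rw [← hm] at hσ ⊢
  have hσ0 : 0 ≤ σ := hσ ▸ sqrt_nonneg _
  have hσ2 : σ ^ 2 = m := by rw [hσ, sq_sqrt (Nat.cast_nonneg _)]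
  have h3 : √3 ^ 2 = 3 := sq_sqrt (by norm_num)
  have hπ := pi_gt_d20
  have hπ' := pi_lt_d20
  have hD' : (0 : ℝ) < D := by exact_mod_cast hD
  have ⟨hs, hs', hr, hr', hDt, hxD, _, _⟩ := h
  have hsl : (s : ℝ) ≤ σ * D := abs_le_of_sq_le_sq' (by
    rw [mul_pow, hσ2, sq, sq, ← mul_assoc]; exact_mod_cast hs) (by positivity) |>.2
  have hsu : σ * D ≤ s + 1 := abs_le_of_sq_le_sq' (by
    rw [mul_pow, hσ2, sq, sq, ← mul_assoc]; exact_mod_cast hs') (by positivity) |>.2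
  have hrl : (r : ℝ) ≤ √3 * σ * D := abs_le_of_sq_le_sq' (by
    rw [mul_pow, mul_pow, h3, hσ2, sq, sq, ← mul_assoc]; exact_mod_cast hr) (by positivity) |>.2
  have hru : √3 * σ * D ≤ r + 1 := abs_le_of_sq_le_sq' (by
    rw [mul_pow, mul_pow, h3, hσ2, sq, sq, ← mul_assoc]; exact_mod_cast hr') (by positivity) |>.2
  have ht0 : 0 ≤ t := by rw [ht]; positivity
  have htl : ((314159265358979323846 * s / (6 * 10 ^ 20) : ℕ) : ℝ) ≤ t * D := by
    refine Nat.cast_div_le.trans ?_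
    push_cast
    rw [div_le_iff₀ (by norm_num)]
    calc (314159265358979323846 : ℝ) * s ≤ (π * 10 ^ 20) * (σ * D) := by
          gcongr; linarith
      _ = _ := by rw [ht]; ring
  have htu : t * D ≤ ((314159265358979323847 * (s + 1) / (6 * 10 ^ 20) + 1 : ℕ) : ℝ) := by
    rw [Nat.cast_add_one]
    refine le_trans ?_ (cast_div_le_natDiv_add_one (by norm_num) _)
    push_cast
    rw [le_div_iff₀ (by norm_num)]
    calc _ = (π * 10 ^ 20) * (σ * D) := by rw [ht]; ring
      _ ≤ _ := by
        gcongr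
        linarith
  have hel := squareIter_le_exp_half hD htl
  have heu := exp_half_le_squareIter hD ht0 htu rfl hxD
  have h1 := h.upper hD htl hru (by positivity) hel
  have h2 := h.lower hD htl htu hrl hel heu
  rw [abs_lt]
  constructor <;> linarith

lemma abs_card_partition_sub_mainTerm_lt_of_small {n : ℕ} (hn : 1 ≤ n) (hn' : n < 800) :
    |(Fintype.card (Nat.Partition n) : ℝ) - mainTerm n| <
      exp (π / 2 * √(2 * n / 3)) / (4 * √3 * n) := by
  have htest := test_of_testAll testAll_numericTest isHistory_one one_ne_zero le_rfl n hn hn'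
  have h := abs_sub_lt_of_numericTest hn htest rfl rfl
  have h1 : (1 : ℝ) ≤ n := by exact_mod_cast hn
  rw [mainTerm]
  generalize (Fintype.card (Nat.Partition n) : ℝ) = q at h ⊢
  set σ := √(24 * n - 1) with hσ
  have hσ2 : σ ^ 2 = 24 * n - 1 := sq_sqrt (by linarith)
  have hσ0 : 0 < σ := sqrt_pos.mpr (by linarith)
  have hπ := pi_pos
  have hle : exp (π * σ / 6 / 2) ≤ exp (π / 2 * √(2 * n / 3)) := by
    rw [exp_le_exp]
    have : σ ≤ 6 * √(2 * n / 3) := by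
      rw [hσ]
      apply sqrt_le_iff.mpr ⟨by positivity, ?_⟩
      rw [mul_pow, sq_sqrt (by positivity)]
      linarith
    nlinarith
  have hE : exp (π * σ / 6) = exp (π * σ / 6 / 2) ^ 2 := by
    rw [← exp_nat_mul]; congr 1; push_cast; ring
  rw [hE, show √12 = 2 * √3 by
    rw [show (12 : ℝ) = 2 ^ 2 * 3 by norm_num, sqrt_mul (by norm_num), sqrt_sq (by norm_num)]]
  refine lt_of_lt_of_le ?_ (div_le_div_of_nonneg_right hle (by positivity))
  rw [← hσ2] at h
  generalize exp (π * σ / 6 / 2) = E at h ⊢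
  have h3 : √3 * √3 = 3 := mul_self_sqrt (by norm_num)
  have h30 : 0 < √3 := by positivity
  rw [lt_div_iff₀ (by positivity), ← mul_lt_mul_iff_left₀ (show 0 < 6 * σ ^ 2 * (π * σ) by positivity)]
  calc _ = |q * σ ^ 2 * (π * (√3 * σ)) * (24 * n) - 36 * (24 * n) * (π * σ / 6 - 1) * E ^ 2| := by
        rw [mul_assoc, ← abs_of_pos (show 0 < 4 * √3 * n * (6 * σ ^ 2 * (π * σ)) by positivity), ← abs_mul]
        congr 1
        field_simp
        linear_combination (1728 * E ^ 2 - 288 * σ * π * E ^ 2) * h3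
    _ < _ := h
    _ = _ := by ring

lemma abs_card_partition_sub_mainTerm_lt {n : ℕ} (hn : 1 ≤ n) :
    |(Fintype.card (Nat.Partition n) : ℝ) - mainTerm n| <
      exp (π / 2 * √(2 * n / 3)) / (4 * √3 * n) := by
  rcases lt_or_ge n 800 with h | h
  · exact abs_card_partition_sub_mainTerm_lt_of_small hn h
  · exact abs_card_partition_sub_mainTerm_lt_of_large h

lemma c_div_rpow_eq {n : ℕ} (hn : 1 ≤ n) (m : ℕ) :
    c m / (n : ℝ) ^ ((m : ℝ) / 2) =
      (-1) ^ m * (coeffSum (π / 6) m * (1 / (2 * √(24 * n))) ^ m) := by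
  have hn' : (0 : ℝ) < n := by exact_mod_cast hn
  have h24 : √(24 * n) = 2 * √6 * √n := by
    rw [show (24 : ℝ) * n = 2 ^ 2 * 6 * n by ring, sqrt_mul (by norm_num),
      sqrt_mul (by norm_num), sqrt_sq (by norm_num)]
  have hpow : (n : ℝ) ^ ((m : ℝ) / 2) = √n ^ m := by
    rw [sqrt_eq_rpow, ← rpow_natCast, ← rpow_mul hn'.le]
    congr 1
    ring
  have h6 : 0 < √6 := by positivity
  have hsn : 0 < √(n : ℝ) := sqrt_pos.mpr hn'
  rw [hpow, h24, show c m = (-1) ^ m / (4 * √6) ^ m * coeffSum (π / 6) m from rfl,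
    show 2 * (2 * √6 * √(n : ℝ)) = 4 * √6 * √n by ring, div_pow, one_pow, mul_pow _ (√(n : ℝ))]
  field_simp

lemma mainTerm_eq {n : ℕ} (hn : 1 ≤ n) :
    4 * √3 * n * exp (-(π * √(2 * n / 3))) * mainTerm n =
      exp (-(π / 6) * ((1 - √(24 * n - 1) / √(24 * n)) / (2 * (1 / (2 * √(24 * n)))))) *
        (1 / (√(24 * n - 1) / √(24 * n)) ^ 2 -
          2 * (1 / (2 * √(24 * n))) / (π / 6 * (√(24 * n - 1) / √(24 * n)) ^ 3)) := by
  have hn' : (1 : ℝ) ≤ n := by exact_mod_cast hn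
  have h23 : √(2 * n / 3) = √(24 * n) / 6 := by
    rw [show (2 * n / 3 : ℝ) = 24 * n / 6 ^ 2 by ring, sqrt_div' _ (by norm_num),
      sqrt_sq (by norm_num)]
  have h12 : √12 = 2 * √3 := by
    rw [show (12 : ℝ) = 2 ^ 2 * 3 by norm_num, sqrt_mul (by norm_num), sqrt_sq (by norm_num)]
  have h3 : √3 * √3 = 3 := mul_self_sqrt (by norm_num)
  have hu2 : √(24 * n) ^ 2 = 24 * n := sq_sqrt (by positivity)
  have hu : 0 < √(24 * n : ℝ) := sqrt_pos.mpr (by linarith)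
  have hs : 0 < √(24 * n - 1 : ℝ) := sqrt_pos.mpr (by linarith)
  rw [mainTerm, h23, h12]
  generalize √(24 * n - 1 : ℝ) = s at hs ⊢
  generalize √(24 * n : ℝ) = u at hu hu2 ⊢
  have hπ := pi_pos
  have hexp : exp (-(π / 6) * ((1 - s / u) / (2 * (1 / (2 * u))))) =
      exp (-(π * (u / 6))) * exp (π * s / 6) := by
    rw [← exp_add]
    congr 1
    field_simp
    ring
  have hfac : 1 / (s / u) ^ 2 - 2 * (1 / (2 * u)) / (π / 6 * (s / u) ^ 3) =
      u ^ 2 / s ^ 2 * (1 - 6 / (π * s)) := by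
    field_simp
  rw [hexp, hfac, hu2, show (24 * n : ℝ) = 4 * √3 * n * (2 * √3) by
    linear_combination (-8 * (n : ℝ)) * h3]
  ring

lemma remainder_bound_eq (N : ℕ) (u : ℝ) :
    cosh (π / 6) / (π / 6) * (2 * ((N : ℝ) + 1) / √(π * (N + 5 / 4))) / u ^ (2 * N + 1) =
      6 * √2 / π ^ ((3 : ℝ) / 2) * cosh (π / 6) *
        (√(2 * N + 2) / u ^ (2 * N + 1)) * √(1 - 1 / (4 * N + 5)) := by
  have hπ := pi_pos
  have h32 : π ^ ((3 : ℝ) / 2) = π * √π := by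
    rw [sqrt_eq_rpow, show (3 : ℝ) / 2 = 1 + 1 / 2 by norm_num, rpow_add hπ, rpow_one]
  have hroot : √2 * √(2 * N + 2) * √(1 - 1 / (4 * N + 5)) =
      2 * ((N : ℝ) + 1) / √(N + 5 / 4) := by
    rw [← sqrt_mul (by norm_num), ← sqrt_mul (by positivity), eq_div_iff (by positivity),
      ← sqrt_mul (mul_nonneg (by positivity) (by
        rw [sub_nonneg, div_le_one (by positivity)]; linarith [Nat.cast_nonneg (α := ℝ) N])),
      sqrt_eq_iff_mul_self_eq_of_pos (by positivity)]
    field_simp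
    ring
  rw [h32, sqrt_mul hπ.le]
  calc _ = 6 / (π * √π) * cosh (π / 6) * (2 * ((N : ℝ) + 1) / √(N + 5 / 4)) / u ^ (2 * N + 1) := by
        field_simp
    _ = _ := by rw [← hroot]; ring

end PartitionExpansion

open PartitionExpansion in
theorem stmt12 (N n : ℕ) (hn : 1 ≤ n) :
    -(6 * Real.sqrt 2 / π ^ ((3 : ℝ) / 2) * Real.cosh (π / 6) *
            (Real.sqrt (2 * N + 2) / Real.sqrt (24 * n) ^ (2 * N + 1)) *
              Real.sqrt (1 - 1 / (4 * N + 5))) -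
        Real.exp (-(π / 2 * Real.sqrt (2 * n / 3))) < R (2 * N + 1) n ∧
      R (2 * N + 1) n < Real.exp (-(π / 2 * Real.sqrt (2 * n / 3))) := by
  have hn' : (1 : ℝ) ≤ n := by exact_mod_cast hn
  have hπ := pi_gt_d4
  have hπ' := pi_lt_d4
  have hs2 : √(24 * n - 1 : ℝ) ^ 2 = 24 * n - 1 := sq_sqrt (by linarith)
  have hu2 : √(24 * n : ℝ) ^ 2 = 24 * n := sq_sqrt (by linarith)
  have hs : 0 < √(24 * n - 1 : ℝ) := sqrt_pos.mpr (by linarith)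
  have hu : 4 ≤ √(24 * n : ℝ) := le_sqrt_of_sq_le (by linarith)
  have h := expansion_remainder (α := π / 6) (t := 1 / (2 * √(24 * n)))
    (s := √(24 * n - 1) / √(24 * n)) (by linarith) (by linarith) (by positivity)
    (by rw [div_le_div_iff₀ (by positivity) (by norm_num)]; linarith) (by positivity)
    (by rw [div_pow, div_pow, mul_pow, hs2, hu2]; field_simp; ring) N
  rw [← mainTerm_eq hn, ← Finset.sum_congr rfl fun m _ => c_div_rpow_eq hn m] at h
  have hmain := abs_card_partition_sub_mainTerm_lt hn
  have hbound := coeffSum_odd_bound (α := π / 6) (by positivity) N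
  have hconst : coeffSum (π / 6) (2 * N + 1) * (1 / (2 * √(24 * n))) ^ (2 * N + 1) ≤
      6 * √2 / π ^ ((3 : ℝ) / 2) * cosh (π / 6) *
        (√(2 * N + 2) / √(24 * n) ^ (2 * N + 1)) * √(1 - 1 / (4 * N + 5)) := by
    rw [← remainder_bound_eq]
    calc _ = coeffSum (π / 6) (2 * N + 1) / 2 ^ (2 * N + 1) / √(24 * n) ^ (2 * N + 1) := by
          rw [div_pow, one_pow, mul_pow]; field_simp
      _ ≤ _ := by gcongr
  have hdiff : |4 * √3 * n * exp (-(π * √(2 * n / 3))) * (p n - mainTerm n)| <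
      exp (-(π / 2 * √(2 * n / 3))) := by
    rw [abs_mul, abs_of_pos (by positivity)]
    calc _ < 4 * √3 * n * exp (-(π * √(2 * n / 3))) *
          (exp (π / 2 * √(2 * n / 3)) / (4 * √3 * n)) := by
          gcongr
          exact hmain
      _ = exp (-(π * √(2 * n / 3))) * exp (π / 2 * √(2 * n / 3)) := by field_simp
      _ = _ := by rw [← exp_add]; congr 1; ring
  rw [abs_lt, mul_sub] at hdiff
  rw [R]
  obtain ⟨h1, h2⟩ := h
  constructor <;> linarith
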